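/- arXiv:math/0501131 — 2 statements merged into one kernel-verified Lean document; each statement's English description precedes it below -/
import Mathlib

section
/- Let ψ ∈ Ω∞, let κ ∈ 𝒦 have dominated growth with respect to ψ (κ ∈ D(ψ)), and let x ∈ M₊(ψ). Then the following statements are equivalent, and when they hold all the limits share the same value A: (i) the sequence {φ_κ(x)(n)}_{n≥1} is Cesàro convergent, i.e. lim_{N→∞} (1/N) Σ_{n=1}^{N} φ_κ(x)(n) = A; (ii) the function φ_κ(x) is Cesàro convergent, i.e. lim_{t→∞} (1/t)∫₀^t φ_κ(x)(s) ds = A; (iii) the sequence {φ_κ(x)(n)}_{n≥1} is almost convergent, i.e. L'({φ_κ(x)(n)}) = A for every Banach limit L' ∈ BL(ℕ); (iv) the function φ_κ(x) is almost convergent at infinity, i.e. L(φ_κ(x)) = A for every Banach limit L ∈ BL(ℝ₊); (v) lim_{n→∞} φ_κ(x)(n) = A; (vi) lim_{t→∞} φ(x)(t) = A. -/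
open MeasureTheory Filter Set

noncomputable section

/-- `f` is bounded and continuous on `[0,∞)`, i.e. (the restriction of) `f`
belongs to `C_b([0,∞))`. -/
def IsCb (f : ℝ → ℝ) : Prop :=
  ContinuousOn f (Ici 0) ∧ ∃ M : ℝ, ∀ t ∈ Ici (0:ℝ), |f t| ≤ M

/-- Bounded real sequences, i.e. elements of `ℓ∞(ℕ)`. -/
def IsBddSeq (a : ℕ → ℝ) : Prop := ∃ M : ℝ, ∀ n, |a n| ≤ M

/-- A Banach limit on `C_b([0,∞))`: a positive linear translation-invariant
functional with `L(1) = 1`.  (The underlying map is defined on all of `ℝ → ℝ`;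
the axioms only refer to its values on bounded continuous functions on `[0,∞)`.) -/
structure BanachLimitR where
  toFun : (ℝ → ℝ) → ℝ
  map_add : ∀ f g : ℝ → ℝ, IsCb f → IsCb g →
    toFun (fun t => f t + g t) = toFun f + toFun g
  map_smul : ∀ (c : ℝ) (f : ℝ → ℝ), IsCb f → toFun (fun t => c * f t) = c * toFun f
  pos : ∀ f : ℝ → ℝ, IsCb f → (∀ t ∈ Ici (0:ℝ), 0 ≤ f t) → 0 ≤ toFun f
  map_one : toFun (fun _ => 1) = 1
  shift_inv : ∀ f : ℝ → ℝ, IsCb f → ∀ s : ℝ, 0 ≤ s → toFun (fun t => f (t + s)) = toFun f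

/-- A Banach limit on `ℓ∞(ℕ)`: a positive linear shift-invariant functional
with `L'(1) = 1`. -/
structure BanachLimitN where
  toFun : (ℕ → ℝ) → ℝ
  map_add : ∀ a b : ℕ → ℝ, IsBddSeq a → IsBddSeq b →
    toFun (fun n => a n + b n) = toFun a + toFun b
  map_smul : ∀ (c : ℝ) (a : ℕ → ℝ), IsBddSeq a → toFun (fun n => c * a n) = c * toFun a
  pos : ∀ a : ℕ → ℝ, IsBddSeq a → (∀ n, 0 ≤ a n) → 0 ≤ toFun a
  map_one : toFun (fun _ => 1) = 1
  shift_inv : ∀ a : ℕ → ℝ, IsBddSeq a → toFun (fun n => a (n + 1)) = toFun a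

/-- An element of `SC_b^*([0,∞))`: a positive linear functional on `C_b([0,∞))`
with `γ(1) = 1` vanishing on `C₀([0,∞))`. -/
structure SCbStar where
  toFun : (ℝ → ℝ) → ℝ
  map_add : ∀ f g : ℝ → ℝ, IsCb f → IsCb g →
    toFun (fun t => f t + g t) = toFun f + toFun g
  map_smul : ∀ (c : ℝ) (f : ℝ → ℝ), IsCb f → toFun (fun t => c * f t) = c * toFun f
  pos : ∀ f : ℝ → ℝ, IsCb f → (∀ t ∈ Ici (0:ℝ), 0 ≤ f t) → 0 ≤ toFun f
  map_one : toFun (fun _ => 1) = 1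
  vanish : ∀ f : ℝ → ℝ, IsCb f → Tendsto f atTop (nhds 0) → toFun f = 0

/-- A positive linear functional on `C_b([0,∞))`. -/
structure PosLinFunc where
  toFun : (ℝ → ℝ) → ℝ
  map_add : ∀ f g : ℝ → ℝ, IsCb f → IsCb g →
    toFun (fun t => f t + g t) = toFun f + toFun g
  map_smul : ∀ (c : ℝ) (f : ℝ → ℝ), IsCb f → toFun (fun t => c * f t) = c * toFun f
  pos : ∀ f : ℝ → ℝ, IsCb f → (∀ t ∈ Ici (0:ℝ), 0 ≤ f t) → 0 ≤ toFun f

/-- `ψ ∈ Ω_∞`: concave on `[0,∞)`, nonnegative, `ψ(t) → 0` as `t → 0⁺` and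
`ψ(t) → ∞` as `t → ∞`. -/
def OmegaInf (ψ : ℝ → ℝ) : Prop :=
  ConcaveOn ℝ (Ici 0) ψ ∧ (∀ t ∈ Ici (0:ℝ), 0 ≤ ψ t) ∧
    Tendsto ψ (nhdsWithin 0 (Ioi 0)) (nhds 0) ∧ Tendsto ψ atTop atTop

/-- The decreasing rearrangement `x*` of a measurable function `x` on `[0,∞)`. -/
def decRearr (x : ℝ → ℝ) (t : ℝ) : ℝ :=
  sInf {s : ℝ | 0 ≤ s ∧ volume {u : ℝ | 0 ≤ u ∧ s < |x u|} ≤ ENNReal.ofReal t}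

/-- The weighted mean function `φ(x)(t) = (1/ψ(t)) ∫₀ᵗ x*(s) ds`. -/
def phiW (ψ x : ℝ → ℝ) (t : ℝ) : ℝ := (∫ s in (0:ℝ)..t, decRearr x s) / ψ t

/-- Membership in the Marcinkiewicz space `M(ψ)`. -/
def MemM (ψ x : ℝ → ℝ) : Prop :=
  Measurable x ∧ ∃ M : ℝ, ∀ t > (0:ℝ), phiW ψ x t ≤ M

/-- Membership in the positive cone `M₊(ψ)`. -/
def MemMplus (ψ x : ℝ → ℝ) : Prop := MemM ψ x ∧ ∀ t ∈ Ici (0:ℝ), 0 ≤ x t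

/-- The Marcinkiewicz norm `‖x‖_{M(ψ)} = sup_{t>0} φ(x)(t)`. -/
def MNorm (ψ x : ℝ → ℝ) : ℝ := ⨆ t > (0:ℝ), phiW ψ x t

/-- `κ ∈ 𝒦`: strictly increasing, invertible (as a map of `[0,∞)` onto itself),
differentiable, unbounded, with `κ(0) = 0`. -/
def MemK (κ : ℝ → ℝ) : Prop :=
  StrictMonoOn κ (Ici 0) ∧ κ 0 = 0 ∧ MapsTo κ (Ici 0) (Ici 0) ∧
    SurjOn κ (Ici 0) (Ici 0) ∧ DifferentiableOn ℝ κ (Ici 0) ∧ Tendsto κ atTop atTop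

/-- `f_{L,κ}(x) = L(φ_κ(x))` for a Banach limit `L` on `C_b([0,∞))`; the function
`φ_κ(x)`, bounded and continuous on `(0,∞)`, is fed to `L` as `t ↦ φ_κ(x)(max t 1)`. -/
def fL (L : BanachLimitR) (ψ κ x : ℝ → ℝ) : ℝ :=
  L.toFun fun t => phiW ψ x (κ (max t 1))

/-- `f_{L',κ}(x) = L'({φ(x)(κ(n))}ₙ)` for a Banach limit `L'` on `ℓ∞(ℕ)`. -/
def fLN (L' : BanachLimitN) (ψ κ x : ℝ → ℝ) : ℝ :=
  L'.toFun fun n => phiW ψ x (κ n)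

/-- `κ` has restricted growth with respect to `ψ` (`κ ∈ R(ψ)`): the sequence
`ψ(κ(n))/ψ(κ(n+1))` is almost convergent to `1`. -/
def RestrictedGrowth (ψ κ : ℝ → ℝ) : Prop :=
  ∀ L' : BanachLimitN, L'.toFun (fun n => ψ (κ n) / ψ (κ ((n:ℝ) + 1))) = 1

/-- `κ` has dominated growth with respect to `ψ` (`κ ∈ D(ψ)`):
`(ψ∘κ)'(t)/(ψ∘κ)(t) < C/t` for some `C > 0` and all `t > 0`. -/
def DominatedGrowth (ψ κ : ℝ → ℝ) : Prop :=
  (∀ t > (0:ℝ), DifferentiableAt ℝ (fun u => ψ (κ u)) t) ∧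
    ∃ C > (0:ℝ), ∀ t > (0:ℝ), deriv (fun u => ψ (κ u)) t / ψ (κ t) < C / t

/-- `κ` is of exponential increase: `κ(t + C) > 2κ(t)` for some `C > 0` and all `t > 0`. -/
def ExpIncrease (κ : ℝ → ℝ) : Prop := ∃ C > (0:ℝ), ∀ t > (0:ℝ), 2 * κ t < κ (t + C)

/-- The piecewise linear extension map `p : ℓ∞(ℕ) → C_b([0,∞))`. -/
def plExt (a : ℕ → ℝ) (t : ℝ) : ℝ :=
  a ⌊t⌋₊ + (a (⌊t⌋₊ + 1) - a ⌊t⌋₊) * (t - (⌊t⌋₊ : ℝ))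

/-- The Cesàro mean `C(g)(μ) = (1/μ) ∫₀^μ g(s) ds` (with `C(g)(0) := g(0)`). -/
def cesaro (g : ℝ → ℝ) (μ : ℝ) : ℝ :=
  if μ = 0 then g 0 else (∫ s in (0:ℝ)..μ, g s) / μ

/-- `M_k(g)(λ) = (1/k(λ)) ∫₀^λ g(s) k'(s) ds` (with `M_k(g)(0) := g(0)`). -/
def MkFun (k g : ℝ → ℝ) (l : ℝ) : ℝ :=
  if l = 0 then g 0 else (∫ s in (0:ℝ)..l, g s * deriv k s) / k l

/-- The Connes-Dixmier functional `τ_{γ,k}(x) = γ(M_k(φ(x)))`; the function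
`M_k(φ(x))`, bounded and continuous on `(0,∞)`, is fed to `γ` as `t ↦ M_k(φ(x))(max t 1)`. -/
def tauCD (γ : SCbStar) (ψ k x : ℝ → ℝ) : ℝ :=
  γ.toFun fun t => MkFun k (phiW ψ x) (max t 1)

/-- A set `Λ` of Banach limits has the Cesàro limit property if for each
`g ∈ C_b([0,∞))` both `liminf C(g)` and `limsup C(g)` are attained as values `L(g)`, `L ∈ Λ`. -/
def CesaroLimitProp (Λ : Set BanachLimitR) : Prop :=
  ∀ g : ℝ → ℝ, IsCb g →
    (∃ L ∈ Λ, L.toFun g = liminf (cesaro g) atTop) ∧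
    (∃ L ∈ Λ, L.toFun g = limsup (cesaro g) atTop)

/-- Dilation invariance of an element of `SC_b^*([0,∞))`. -/
def DilationInvariant (ω : SCbStar) : Prop :=
  ∀ g : ℝ → ℝ, IsCb g → ∀ a : ℝ, 0 < a → ω.toFun (fun t => g (a * t)) = ω.toFun g


lemma decRearr_nonneg (x : ℝ → ℝ) (t : ℝ) : 0 ≤ decRearr x t :=
  Real.sInf_nonneg (fun _ hs => hs.1)

lemma decRearr_anti (x : ℝ → ℝ) (hx : Measurable x) : AntitoneOn (decRearr x) (Ioi 0) := by
  intro a ha b hb hab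
  simp only [mem_Ioi] at ha hb
  by_cases hne : ∃ s : ℝ, 0 ≤ s ∧ volume {u : ℝ | 0 ≤ u ∧ s < |x u|} < ⊤
  · obtain ⟨s0, hs0, hfin⟩ := hne
    have hmeas : ∀ s : ℝ, MeasurableSet {u : ℝ | 0 ≤ u ∧ s < |x u|} := by
      intro s
      exact (measurableSet_le measurable_const measurable_id).inter
        (measurableSet_lt measurable_const (by simpa using hx.abs))
    have hlim : Tendsto (fun n : ℕ => volume {u : ℝ | 0 ≤ u ∧ s0 + n < |x u|}) atTop
        (nhds (volume (⋂ n : ℕ, {u : ℝ | 0 ≤ u ∧ s0 + n < |x u|}))) := by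
      apply tendsto_measure_iInter_atTop (fun n => (hmeas _).nullMeasurableSet)
      · intro m n hmn u hu
        refine ⟨hu.1, lt_of_le_of_lt ?_ hu.2⟩
        have : (m:ℝ) ≤ n := by exact_mod_cast hmn
        linarith
      · exact ⟨0, by simpa using hfin.ne⟩
    have hemp : (⋂ n : ℕ, {u : ℝ | 0 ≤ u ∧ s0 + n < |x u|}) = ∅ := by
      ext u
      simp only [mem_iInter, mem_ofPred_eq, mem_empty_iff_false, iff_false, not_forall]
      obtain ⟨n, hn⟩ := exists_nat_gt (|x u|)
      exact ⟨n, fun h => by linarith [h.2]⟩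
    rw [hemp, measure_empty] at hlim
    have hev := hlim.eventually (gt_mem_nhds (ENNReal.ofReal_pos.2 ha))
    obtain ⟨n, hn⟩ := hev.exists
    apply csInf_le_csInf
    · exact ⟨0, fun s hs => hs.1⟩
    · exact ⟨s0 + n, by positivity, hn.le⟩
    · intro s hs
      exact ⟨hs.1, hs.2.trans (ENNReal.ofReal_le_ofReal hab)⟩
  · push Not at hne
    have : {s : ℝ | 0 ≤ s ∧ volume {u : ℝ | 0 ≤ u ∧ s < |x u|} ≤ ENNReal.ofReal b} = ∅ := by
      ext s
      simp only [mem_ofPred_eq, mem_empty_iff_false, iff_false, not_and]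
      intro hs h
      have := (hne s hs).trans h
      exact absurd this (by simp)
    unfold decRearr
    rw [this, Real.sInf_empty]
    exact decRearr_nonneg x a

lemma prim_props (f : ℝ → ℝ) (h0 : ∀ t, 0 ≤ f t) (ha : AntitoneOn f (Ioi 0)) :
    MonotoneOn (fun t => ∫ s in (0:ℝ)..t, f s) (Ici 0) ∧
    ContinuousOn (fun t => ∫ s in (0:ℝ)..t, f s) (Ici 0) := by
  have hI : ∀ a b : ℝ, 0 < a → 0 < b → IntervalIntegrable f volume a b := by
    intro a b ha' hb'
    apply AntitoneOn.intervalIntegrable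
    apply ha.mono
    intro z hz
    exact lt_of_lt_of_le (lt_min ha' hb') hz.1
  by_cases h1 : IntervalIntegrable f volume 0 1
  · have hall : ∀ t : ℝ, 0 ≤ t → IntervalIntegrable f volume 0 t := by
      intro t ht
      rcases ht.eq_or_lt with rfl | ht
      · simp
      · exact h1.trans (hI 1 t one_pos ht)
    constructor
    · intro a ha b hb hab
      exact intervalIntegral.integral_mono_interval le_rfl ha hab
        (Eventually.of_forall h0) (hall b hb)
    · intro t ht
      have ht' : (0:ℝ) ≤ t := ht
      have hc := intervalIntegral.continuousOn_primitive_interval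
        (f := f) (μ := volume) (a := 0) (b := t + 1)
        (by rw [uIcc_of_le (by linarith)]
            exact (intervalIntegrable_iff_integrableOn_Icc_of_le (by linarith)).1
              (hall (t+1) (by linarith)))
      rw [uIcc_of_le (by linarith)] at hc
      have := hc t ⟨ht', by linarith⟩
      apply this.mono_of_mem_nhdsWithin
      rw [← Ici_inter_Iic]
      exact inter_mem self_mem_nhdsWithin (mem_nhdsWithin_of_mem_nhds (Iic_mem_nhds (by linarith)))
  · have hz : ∀ t ∈ Ici (0:ℝ), (fun t => ∫ s in (0:ℝ)..t, f s) t = (fun _ => (0:ℝ)) t := by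
      intro t ht
      rcases (show (0:ℝ) ≤ t from ht).eq_or_lt with rfl | ht
      · simp
      · apply intervalIntegral.integral_undef
        intro h
        exact h1 (h.trans (hI t 1 ht one_pos))
    refine ⟨?_, continuousOn_const.congr hz⟩
    intro a ha b hb hab
    rw [hz a ha, hz b hb]

lemma omega_pos (ψ : ℝ → ℝ) (h : OmegaInf ψ) (t : ℝ) (ht : 0 < t) : 0 < ψ t := by
  obtain ⟨hc, hn, -, hinf⟩ := h
  obtain ⟨T, hT1, hT2⟩ := ((hinf.eventually_gt_atTop 0).and (eventually_gt_atTop t)).exists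
  have hT : 0 < T := ht.trans hT2
  have := hc.2 (show (0:ℝ) ∈ Ici (0:ℝ) by simp) (show T ∈ Ici (0:ℝ) from hT.le)
    (show 0 ≤ 1 - t/T by rw [sub_nonneg, div_le_one hT]; exact hT2.le)
    (show 0 ≤ t/T by positivity) (by ring)
  have e : (1 - t/T) • (0:ℝ) + (t/T) • T = t := by
    simp; field_simp
  rw [e] at this
  refine lt_of_lt_of_le ?_ this
  have h0 := hn 0 (by simp)
  have h1 : 0 ≤ 1 - t/T := by rw [sub_nonneg, div_le_one hT]; exact hT2.le
  have h2 : 0 < t / T := by positivity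
  simp only [smul_eq_mul]
  positivity

/-- Slow decrease. -/
lemma g_props (ψ κ x : ℝ → ℝ) (hψ : OmegaInf ψ) (hκ : MemK κ)
    (hD : DominatedGrowth ψ κ) (hx : MemMplus ψ x) :
    ∃ M K : ℝ, 0 ≤ M ∧ 0 ≤ K ∧ (∀ t : ℝ, 0 ≤ t → 0 ≤ phiW ψ x (κ t) ∧ phiW ψ x (κ t) ≤ M) ∧
      ContinuousOn (fun t => phiW ψ x (κ t)) (Ioi 0) ∧
      (phiW ψ x (κ 0) = 0) ∧
      ∀ t s : ℝ, 0 < t → t ≤ s → phiW ψ x (κ t) - phiW ψ x (κ s) ≤ K * ((s - t) / t) := by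
  obtain ⟨⟨hxm, M, hM⟩, -⟩ := hx
  obtain ⟨hd, C, hC, hDC⟩ := hD
  obtain ⟨hmono, hκ0, hmaps, -, hdiff, -⟩ := hκ
  obtain ⟨Fm, Fc⟩ := prim_props (decRearr x) (decRearr_nonneg x) (decRearr_anti x hxm)
  have hκpos : ∀ t : ℝ, 0 < t → 0 < κ t := fun t ht => by
    have := hmono (a := 0) (b := t) (by simp) ht.le ht
    rwa [hκ0] at this
  have hΨ : ∀ t : ℝ, 0 < t → 0 < ψ (κ t) := fun t ht => omega_pos ψ hψ _ (hκpos t ht)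
  have hF0 : ∀ t : ℝ, 0 ≤ t → 0 ≤ ∫ s in (0:ℝ)..t, decRearr x s := fun t ht =>
    intervalIntegral.integral_nonneg ht (fun u _ => decRearr_nonneg x u)
  have hg0 : phiW ψ x (κ 0) = 0 := by simp [phiW, hκ0]
  have hgn : ∀ t : ℝ, 0 ≤ t → 0 ≤ phiW ψ x (κ t) := fun t ht =>
    div_nonneg (hF0 _ (hmaps ht)) (hψ.2.1 _ (hmaps ht))
  refine ⟨max M 0, max M 0 * C, le_max_right _ _, by positivity, ?_, ?_, hg0, ?_⟩
  · intro t ht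
    refine ⟨hgn t ht, ?_⟩
    rcases ht.eq_or_lt with rfl | ht
    · rw [hg0]; exact le_max_right _ _
    · exact (hM _ (hκpos t ht)).trans (le_max_left _ _)
  · apply ContinuousOn.div
    · exact Fc.comp (hdiff.continuousOn.mono Ioi_subset_Ici_self)
        (fun t ht => hmaps (Ioi_subset_Ici_self ht))
    · exact fun t ht => (hd t ht).continuousAt.continuousWithinAt
    · exact fun t ht => (hΨ t ht).ne'
  · intro t s ht hts
    have hs : 0 < s := ht.trans_le hts
    have hanti : AntitoneOn (fun u => Real.log (ψ (κ u)) - C * Real.log u) (Ioi 0) := by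
      have hda : ∀ u ∈ Ioi (0:ℝ), HasDerivAt (fun u => Real.log (ψ (κ u)) - C * Real.log u)
          (deriv (fun u => ψ (κ u)) u / ψ (κ u) - C * u⁻¹) u := by
        intro u hu
        exact ((hd u hu).hasDerivAt.log (hΨ u hu).ne').sub
          ((Real.hasDerivAt_log (ne_of_gt hu)).const_mul C)
      apply antitoneOn_of_deriv_nonpos (convex_Ioi 0)
      · exact fun u hu => (hda u hu).continuousAt.continuousWithinAt
      · rw [interior_Ioi]
        exact fun u hu => (hda u hu).differentiableAt.differentiableWithinAt
      · rw [interior_Ioi]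
        intro u hu
        rw [(hda u hu).deriv]
        have := hDC u hu
        rw [div_eq_mul_inv C u] at this
        linarith
    have h1 := hanti (show t ∈ Ioi 0 from ht) (show s ∈ Ioi 0 from hs) hts
    simp only at h1
    have h2 : Real.log s - Real.log t ≤ (s - t) / t := by
      rw [← Real.log_div hs.ne' ht.ne']
      have := Real.log_le_sub_one_of_pos (div_pos hs ht)
      have e : s / t - 1 = (s - t) / t := by field_simp
      linarith
    have h3 : 1 - C * ((s - t)/t) ≤ ψ (κ t) / ψ (κ s) := by
      have hp : 0 < ψ (κ t) / ψ (κ s) := div_pos (hΨ t ht) (hΨ s hs)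
      have := Real.add_one_le_exp (Real.log (ψ (κ t) / ψ (κ s)))
      rw [Real.exp_log hp, Real.log_div (hΨ t ht).ne' (hΨ s hs).ne'] at this
      have h4 := mul_le_mul_of_nonneg_left h2 hC.le
      linarith
    have hFm : (∫ s in (0:ℝ)..κ t, decRearr x s) ≤ ∫ s in (0:ℝ)..κ s, decRearr x s :=
      Fm (hmaps ht.le) (hmaps hs.le) (hmono.monotoneOn ht.le hs.le hts)
    have h5 : phiW ψ x (κ t) * (ψ (κ t) / ψ (κ s)) ≤ phiW ψ x (κ s) := by
      unfold phiW
      have := (hΨ t ht).ne'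
      rw [div_mul_div_cancel₀ this]
      exact div_le_div_of_nonneg_right hFm (hΨ s hs).le
    have h6 := mul_le_mul_of_nonneg_left h3 (hgn t ht.le)
    have h7 : phiW ψ x (κ t) ≤ max M 0 := (hM _ (hκpos t ht)).trans (le_max_left _ _)
    have h8 : 0 ≤ C * ((s - t)/t) := by
      have : 0 ≤ s - t := by linarith
      positivity
    have h9 := mul_le_mul_of_nonneg_right h7 h8
    nlinarith

/-- Discrete Tauberian lemma. -/
lemma taub (a H : ℕ → ℝ) (A : ℝ) (hH : Tendsto (fun n : ℕ => H n / n) atTop (nhds A))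
    (hs : ∀ ε > (0:ℝ), ∃ δ : ℝ, 0 < δ ∧ δ < 1 ∧ ∃ N0 : ℕ, ∀ n k : ℕ, N0 ≤ n → (k:ℝ) ≤ δ * n →
      k * (a n - ε) ≤ H (n + k) - H n ∧ H n - H (n - k) ≤ k * (a n + ε)) :
    Tendsto a atTop (nhds A) := by
  rw [Metric.tendsto_atTop]
  intro ε hε
  obtain ⟨δ, hδ, hδ1, N0, h⟩ := hs (ε/4) (by positivity)
  set η := ε * δ / 16 with hη
  have hηp : 0 < η := by positivity
  rw [Metric.tendsto_atTop] at hH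
  obtain ⟨N1, hN1⟩ := hH η hηp
  have hb : ∀ m : ℕ, N1 ≤ m → 0 < m → |H m - A * m| ≤ η * m := by
    intro m hm hm0
    have h1 := (hN1 m hm).le
    have hm' : (0:ℝ) < m := by exact_mod_cast hm0
    rw [Real.dist_eq] at h1
    have e : H m - A * m = (H m / m - A) * m := by field_simp
    rw [e, abs_mul, abs_of_pos hm']
    exact mul_le_mul_of_nonneg_right h1 hm'.le
  obtain ⟨N2, hN2⟩ := exists_nat_gt (2 / δ)
  obtain ⟨N3, hN3⟩ := exists_nat_gt ((N1 + 1) / (1 - δ))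
  refine ⟨max (max N0 N1) (max N2 N3), fun n hn => ?_⟩
  simp only [ge_iff_le, max_le_iff] at hn
  obtain ⟨⟨hn0, hn1⟩, hn2, hn3⟩ := hn
  have hn2' : 2 / δ < n := hN2.trans_le (by exact_mod_cast hn2)
  have hn3' : (N1 + 1) / (1 - δ) < n := hN3.trans_le (by exact_mod_cast hn3)
  rw [div_lt_iff₀ hδ] at hn2'
  rw [div_lt_iff₀ (by linarith)] at hn3'
  have hnpos : (0:ℝ) < n := by
    by_contra hh
    push Not at hh
    nlinarith
  have hnp : 0 < n := by exact_mod_cast hnpos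
  set k := ⌊δ * n⌋₊ with hk
  have hk1 : (k:ℝ) ≤ δ * n := Nat.floor_le (by positivity)
  have hk2 : δ * n < k + 1 := Nat.lt_floor_add_one _
  have hk3 : δ * n / 2 ≤ k := by nlinarith
  have hkpos : (0:ℝ) < k := lt_of_lt_of_le (by positivity) hk3
  have hkn : (k:ℝ) ≤ n := by nlinarith
  have hkn' : k ≤ n := by exact_mod_cast hkn
  obtain ⟨u1, u2⟩ := h n k hn0 hk1
  have c1 := abs_le.1 (hb n hn1 hnp)
  have c2 := abs_le.1 (hb (n + k) (by omega) (by omega))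
  have hnk : ((n - k : ℕ) : ℝ) = n - k := by push_cast [hkn']; ring
  have hnk1 : (N1:ℝ) + 1 ≤ ((n - k : ℕ):ℝ) := by rw [hnk]; nlinarith
  have hnk2 : N1 + 1 ≤ n - k := by exact_mod_cast hnk1
  have c3 := abs_le.1 (hb (n - k) (by omega) (by omega))
  rw [hnk] at c3
  push_cast at c2
  have hηn : η * n ≤ ε / 8 * k := by rw [hη]; nlinarith
  have hηk : η * k ≤ η * n := mul_le_mul_of_nonneg_left hkn hηp.le
  have f1 : k * (a n - ε/4 - A) ≤ k * (3 * ε / 8) := by nlinarith [c1.1, c2.2]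
  have f2 : k * (A - a n - ε/4) ≤ k * (3 * ε / 8) := by nlinarith [c1.1, c3.2]
  have g1 := le_of_mul_le_mul_left f1 hkpos
  have g2 := le_of_mul_le_mul_left f2 hkpos
  rw [Real.dist_eq, abs_lt]
  constructor <;> linarith

/-- bounded functions converge along ultrafilters -/
lemma ultra_conv {ι : Type*} (U : Ultrafilter ι) (u : ι → ℝ) (M : ℝ)
    (h : ∀ᶠ i in (U : Filter ι), |u i| ≤ M) : Tendsto u U (nhds (limUnder (U : Filter ι) u)) := by
  apply tendsto_nhds_limUnder
  obtain ⟨l, -, hl⟩ := (isCompact_Icc (a := -M) (b := M)).ultrafilter_le_nhds (U.map u)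
    (by
      rw [le_principal_iff]
      exact h.mono fun i hi => abs_le.1 hi)
  exact ⟨l, hl⟩

def meanN (a : ℕ → ℝ) (N : ℕ) : ℝ := (∑ n ∈ Finset.range N, a n) / N

lemma meanN_bdd (a : ℕ → ℝ) (M : ℝ) (h : ∀ n, |a n| ≤ M) (N : ℕ) : |meanN a N| ≤ M := by
  have hM : 0 ≤ M := (abs_nonneg _).trans (h 0)
  unfold meanN
  rw [abs_div, Nat.abs_cast]
  apply div_le_of_le_mul₀ (by positivity) hM
  calc _ ≤ ∑ n ∈ Finset.range N, |a n| := Finset.abs_sum_le_sum_abs _ _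
    _ ≤ ∑ n ∈ Finset.range N, M := Finset.sum_le_sum fun i _ => h i
    _ = M * N := by simp [mul_comm]

lemma meanN_conv (U : Ultrafilter ℕ) (a : ℕ → ℝ) (h : IsBddSeq a) :
    Tendsto (meanN a) U (nhds (limUnder (U : Filter ℕ) (meanN a))) := by
  obtain ⟨M, hM⟩ := h
  exact ultra_conv U _ M (Eventually.of_forall (meanN_bdd a M hM))

def blN (U : Ultrafilter ℕ) (hU : (U : Filter ℕ) ≤ atTop) : BanachLimitN where
  toFun a := limUnder (U : Filter ℕ) (meanN a)
  map_add a b ha hb := by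
    apply Tendsto.limUnder_eq
    refine ((meanN_conv U a ha).add (meanN_conv U b hb)).congr fun N => ?_
    simp [meanN, Finset.sum_add_distrib, add_div]
  map_smul c a ha := by
    apply Tendsto.limUnder_eq
    refine ((meanN_conv U a ha).const_mul c).congr fun N => ?_
    simp [meanN, ← Finset.mul_sum, mul_div_assoc]
  pos a ha h0 := by
    refine ge_of_tendsto' (meanN_conv U a ha) fun N => ?_
    exact div_nonneg (Finset.sum_nonneg fun i _ => h0 i) (by positivity)
  map_one := by
    apply Tendsto.limUnder_eq
    apply Tendsto.mono_left _ hU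
    refine tendsto_const_nhds.congr' ?_
    filter_upwards [eventually_gt_atTop 0] with N hN
    have : (N:ℝ) ≠ 0 := by positivity
    simp [meanN, this]
  shift_inv a ha := by
    apply Tendsto.limUnder_eq
    obtain ⟨M, hM⟩ := id ha
    have h1 : Tendsto (fun N : ℕ => (a N - a 0) / (N:ℝ)) atTop (nhds 0) := by
      apply squeeze_zero_norm (a := fun N : ℕ => (M + M) / (N:ℝ)) _
        (tendsto_const_div_atTop_nhds_zero_nat _)
      intro N
      rw [Real.norm_eq_abs, abs_div, Nat.abs_cast]
      apply div_le_div_of_nonneg_right _ (by positivity)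
      exact (abs_sub _ _).trans (add_le_add (hM _) (hM _))
    have := (meanN_conv U a ha).add (h1.mono_left hU)
    rw [add_zero] at this
    refine this.congr fun N => ?_
    have e := Finset.sum_range_succ a N
    rw [Finset.sum_range_succ'] at e
    simp only [meanN]
    rw [← add_div]
    congr 1
    linarith

def meanR (f : ℝ → ℝ) (T : ℝ) : ℝ := (∫ s in (0:ℝ)..T, f s) / T

lemma IsCb.ii {f : ℝ → ℝ} (h : IsCb f) {a b : ℝ} (ha : 0 ≤ a) (hb : 0 ≤ b) :
    IntervalIntegrable f volume a b := by
  apply ContinuousOn.intervalIntegrable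
  apply h.1.mono
  intro z hz
  exact (le_min ha hb).trans hz.1

lemma int_bdd {f : ℝ → ℝ} {M : ℝ} (h : ∀ t ∈ Ici (0:ℝ), |f t| ≤ M) {a b : ℝ} (ha : 0 ≤ a)
    (hb : a ≤ b) : |∫ s in a..b, f s| ≤ M * (b - a) := by
  have := intervalIntegral.norm_integral_le_of_norm_le_const (f := f) (a := a) (b := b) (C := M)
    (by
      intro z hz
      rw [uIoc_of_le hb] at hz
      exact h z (ha.trans hz.1.le))
  rwa [Real.norm_eq_abs, abs_of_nonneg (sub_nonneg.2 hb)] at this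

lemma meanR_conv (U : Ultrafilter ℝ) (hU : (U : Filter ℝ) ≤ atTop) (f : ℝ → ℝ) (h : IsCb f) :
    Tendsto (meanR f) U (nhds (limUnder (U : Filter ℝ) (meanR f))) := by
  obtain ⟨-, M, hM⟩ := h
  apply ultra_conv U _ M
  apply hU
  filter_upwards [eventually_gt_atTop 0] with T hT
  unfold meanR
  rw [abs_div, abs_of_pos hT, div_le_iff₀ hT]
  simpa using int_bdd hM le_rfl hT.le

def blR (U : Ultrafilter ℝ) (hU : (U : Filter ℝ) ≤ atTop) : BanachLimitR where
  toFun a := limUnder (U : Filter ℝ) (meanR a)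
  map_add a b ha hb := by
    apply Tendsto.limUnder_eq
    refine ((meanR_conv U hU a ha).add (meanR_conv U hU b hb)).congr' ?_
    apply hU
    filter_upwards [eventually_gt_atTop 0] with T hT
    simp only [meanR]
    rw [intervalIntegral.integral_add (ha.ii le_rfl hT.le) (hb.ii le_rfl hT.le), add_div]
  map_smul c a ha := by
    apply Tendsto.limUnder_eq
    refine ((meanR_conv U hU a ha).const_mul c).congr fun N => ?_
    simp [meanR, mul_div_assoc]
  pos a ha h0 := by
    refine ge_of_tendsto (meanR_conv U hU a ha) ?_
    apply hU
    filter_upwards [eventually_gt_atTop 0] with T hT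
    exact div_nonneg (intervalIntegral.integral_nonneg hT.le fun u hu => h0 u hu.1) hT.le
  map_one := by
    apply Tendsto.limUnder_eq
    apply Tendsto.mono_left _ hU
    refine tendsto_const_nhds.congr' ?_
    filter_upwards [eventually_gt_atTop 0] with T hT
    simp [meanR, hT.ne']
  shift_inv f hf s hs := by
    apply Tendsto.limUnder_eq
    obtain ⟨M, hM⟩ := hf.2
    have h1 : Tendsto (fun T : ℝ => ((∫ u in T..(T+s), f u) - ∫ u in (0:ℝ)..s, f u) / T)
        atTop (nhds 0) := by
      apply squeeze_zero_norm' (a := fun T : ℝ => (M * s + M * s) / T) _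
        (tendsto_const_nhds.div_atTop tendsto_id)
      filter_upwards [eventually_gt_atTop 0] with T hT
      rw [Real.norm_eq_abs, abs_div, abs_of_pos hT]
      apply div_le_div_of_nonneg_right _ hT.le
      refine (abs_sub _ _).trans (add_le_add ?_ ?_)
      · simpa using int_bdd hM hT.le (show T ≤ T + s by linarith)
      · simpa using int_bdd hM le_rfl hs
    have := (meanR_conv U hU f hf).add (h1.mono_left hU)
    rw [add_zero] at this
    refine this.congr' ?_
    apply hU
    filter_upwards [eventually_gt_atTop 0] with T hT
    simp only [meanR]
    rw [← add_div, intervalIntegral.integral_comp_add_right, zero_add]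
    congr 1
    have e1 := intervalIntegral.integral_add_adjacent_intervals
      (hf.ii le_rfl hT.le) (hf.ii hT.le (show 0 ≤ T + s by linarith))
    have e2 := intervalIntegral.integral_add_adjacent_intervals
      (hf.ii le_rfl hs) (hf.ii hs (show 0 ≤ T + s by linarith))
    linarith

lemma ban_N (a : ℕ → ℝ) (A : ℝ) (ha : IsBddSeq a) (h : ∀ L : BanachLimitN, L.toFun a = A) :
    Tendsto (meanN a) atTop (nhds A) := by
  rw [tendsto_iff_ultrafilter]
  intro U hU
  have := meanN_conv U a ha
  rwa [show limUnder (U : Filter ℕ) (meanN a) = A from h (blN U hU)] at this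

lemma ban_R (f : ℝ → ℝ) (A : ℝ) (hf : IsCb f) (h : ∀ L : BanachLimitR, L.toFun f = A) :
    Tendsto (meanR f) atTop (nhds A) := by
  rw [tendsto_iff_ultrafilter]
  intro U hU
  have := meanR_conv U hU f hf
  rwa [show limUnder (U : Filter ℝ) (meanR f) = A from h (blR U hU)] at this

lemma lim_N (L : BanachLimitN) (a : ℕ → ℝ) (A : ℝ) (ha : IsBddSeq a)
    (h : Tendsto a atTop (nhds A)) : L.toFun a = A := by
  have hshift : ∀ N : ℕ, L.toFun (fun n => a (n + N)) = L.toFun a := by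
    intro N
    induction N with
    | zero => rfl
    | succ N ih =>
      rw [← ih]
      have hb : IsBddSeq fun n => a (n + N) := ha.imp fun M hM n => hM _
      rw [← L.shift_inv _ hb]
      congr 1; ext n; congr 1; ring
  have hconst : ∀ c : ℝ, IsBddSeq fun _ => c := fun c => ⟨|c|, fun _ => le_rfl⟩
  have hLc : ∀ c : ℝ, L.toFun (fun _ => c) = c := fun c => by
    have := L.map_smul c (fun _ => 1) (hconst 1)
    simpa [L.map_one] using this
  apply eq_of_abs_sub_le_all
  intro ε hε
  rw [Metric.tendsto_atTop] at h
  obtain ⟨N, hN⟩ := h ε hε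
  have hb : IsBddSeq fun n => a (n + N) := ha.imp fun M hM n => hM _
  have hnb : IsBddSeq fun n => (-1) * a (n + N) := by
    obtain ⟨M, hM⟩ := hb
    exact ⟨M, fun n => by simpa using hM n⟩
  have hd : ∀ n, |a (n + N) - A| < ε := fun n => hN _ (by omega)
  have hadd : ∀ (b : ℕ → ℝ) (c : ℝ), IsBddSeq b → IsBddSeq fun n => b n + c := by
    rintro b c ⟨M, hM⟩
    exact ⟨M + |c|, fun n => (abs_add_le _ _).trans (add_le_add (hM n) le_rfl)⟩
  have p1 := L.pos _ (hadd _ (ε - A) hb) (fun n => by linarith [(abs_lt.1 (hd n)).1])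
  have p2 := L.pos _ (hadd _ (ε + A) hnb) (fun n => by linarith [(abs_lt.1 (hd n)).2])
  rw [L.map_add _ _ hb (hconst _), hLc, hshift] at p1
  rw [L.map_add _ _ hnb (hconst _), hLc, L.map_smul _ _ hb, hshift] at p2
  rw [abs_le]; constructor <;> linarith

lemma lim_R (L : BanachLimitR) (f : ℝ → ℝ) (A : ℝ) (hf : IsCb f)
    (h : Tendsto f atTop (nhds A)) : L.toFun f = A := by
  have hconst : ∀ c : ℝ, IsCb fun _ => c := fun c => ⟨continuousOn_const, |c|, fun _ _ => le_rfl⟩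
  have hLc : ∀ c : ℝ, L.toFun (fun _ => c) = c := fun c => by
    have := L.map_smul c (fun _ => 1) (hconst 1)
    simpa [L.map_one] using this
  apply eq_of_abs_sub_le_all
  intro ε hε
  rw [Metric.tendsto_atTop] at h
  obtain ⟨N', hN'⟩ := h ε hε
  obtain ⟨N, hN0, hN⟩ : ∃ N : ℝ, 0 ≤ N ∧ ∀ n ≥ N, dist (f n) A < ε :=
    ⟨max N' 0, le_max_right _ _, fun n hn => hN' n ((le_max_left _ _).trans hn)⟩
  have hshift := L.shift_inv f hf N hN0
  have hmap : MapsTo (fun n : ℝ => n + N) (Ici 0) (Ici 0) := fun t ht => by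
    simp only [mem_Ici] at *; linarith
  have hb : IsCb fun n => f (n + N) := by
    obtain ⟨hc, M, hM⟩ := hf
    exact ⟨hc.comp (by fun_prop) hmap, M, fun t ht => hM _ (hmap ht)⟩
  have hnb : IsCb fun n => (-1) * f (n + N) := by
    obtain ⟨hc, M, hM⟩ := hb
    exact ⟨continuousOn_const.mul hc, M, fun n hn => by simpa using hM n hn⟩
  have hd : ∀ n ∈ Ici (0:ℝ), |f (n + N) - A| < ε := fun n hn => hN _ (by
    simp only [mem_Ici] at hn; linarith)
  have hadd : ∀ (b : ℝ → ℝ) (c : ℝ), IsCb b → IsCb fun n => b n + c := by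
    rintro b c ⟨hc, M, hM⟩
    exact ⟨hc.add continuousOn_const, M + |c|,
      fun n hn => (abs_add_le _ _).trans (add_le_add (hM n hn) le_rfl)⟩
  have p1 := L.pos _ (hadd _ (ε - A) hb) (fun n hn => by linarith [(abs_lt.1 (hd n hn)).1])
  have p2 := L.pos _ (hadd _ (ε + A) hnb) (fun n hn => by linarith [(abs_lt.1 (hd n hn)).2])
  rw [L.map_add _ _ hb (hconst _), hLc, hshift] at p1
  rw [L.map_add _ _ hnb (hconst _), hLc, L.map_smul _ _ hb, hshift] at p2
  rw [abs_le]; constructor <;> linarith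

section core
variable {g : ℝ → ℝ} {M K : ℝ}

lemma win (hK : 0 ≤ K) (hs : ∀ t s : ℝ, 0 < t → t ≤ s → g t - g s ≤ K * ((s - t) / t))
    (ε : ℝ) (hε : 0 < ε) : ∃ δ : ℝ, 0 < δ ∧ δ < 1 ∧ ∀ n k : ℕ, 1 ≤ n → (k:ℝ) ≤ δ * n →
      k < n ∧
      (∀ s : ℝ, (n:ℝ) ≤ s → s ≤ n + k → g n - ε ≤ g s) ∧
      (∀ s : ℝ, (n:ℝ) - k ≤ s → s ≤ n → g s ≤ g n + ε) := by
  have key : ∀ δ n t s : ℝ, 0 < δ → δ ≤ ε / (2 * (K + 1)) → 0 < n → n / 2 ≤ t → t ≤ s →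
      s - t ≤ δ * n → g t - g s ≤ ε := by
    intro δ n t s hδ hδ' hn ht hts hst
    have ht0 : 0 < t := by linarith
    refine (hs t s ht0 hts).trans ?_
    rw [le_div_iff₀ (by positivity)] at hδ'
    rw [← mul_div_assoc, div_le_iff₀ ht0]
    have h1 : K * (s - t) ≤ K * (δ * n) := mul_le_mul_of_nonneg_left hst hK
    have h2 : K * (δ * n) ≤ (K + 1) * (δ * n) := by
      apply mul_le_mul_of_nonneg_right _ (by positivity); linarith
    have h3 : ε * (n / 2) ≤ ε * t := mul_le_mul_of_nonneg_left ht hε.le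
    have h4 := mul_le_mul_of_nonneg_right hδ' (show 0 ≤ n / 2 by positivity)
    nlinarith
  refine ⟨min (1/2) (ε / (2 * (K + 1))), by positivity,
    (min_le_left _ _).trans_lt (by norm_num), ?_⟩
  intro n k hn hk
  have hn' : (0:ℝ) < n := by exact_mod_cast hn
  have hd0 : 0 < min (1/2) (ε / (2 * (K + 1))) := by positivity
  have hk2 : (k:ℝ) ≤ 1/2 * n := hk.trans (mul_le_mul_of_nonneg_right (min_le_left _ _) hn'.le)
  refine ⟨?_, ?_, ?_⟩
  · have : (k:ℝ) < n := by linarith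
    exact_mod_cast this
  · intro s h1 h2
    have := key _ n n s hd0 (min_le_right _ _) hn' (by linarith) h1 (by linarith)
    linarith
  · intro s h1 h2
    have := key _ n s n hd0 (min_le_right _ _) hn' (by linarith) h2 (by linarith)
    linarith

lemma cesN (hK : 0 ≤ K) (hs : ∀ t s : ℝ, 0 < t → t ≤ s → g t - g s ≤ K * ((s - t) / t)) (A : ℝ)
    (h : Tendsto (fun N : ℕ => (∑ i ∈ Finset.range N, g ((i + 1 : ℕ):ℝ)) / (N:ℝ)) atTop (nhds A)) :
    Tendsto (fun n : ℕ => g n) atTop (nhds A) := by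
  apply taub _ (fun N => ∑ i ∈ Finset.range N, g ((i + 1 : ℕ):ℝ)) A h
  intro ε hε
  obtain ⟨δ, h0, h1, hw⟩ := win hK hs ε hε
  refine ⟨δ, h0, h1, 1, fun n k hn hk => ?_⟩
  obtain ⟨hkn, w1, w2⟩ := hw n k hn hk
  constructor
  · rw [Finset.sum_range_add, add_sub_cancel_left]
    have := Finset.card_nsmul_le_sum (Finset.range k) (fun i => g ((n + i + 1 : ℕ):ℝ)) (g n - ε)
      (by
        intro i hi
        have hi' : i + 1 ≤ k := by simpa using hi
        have hi'' : (i:ℝ) + 1 ≤ k := by exact_mod_cast hi'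
        apply w1 <;> push_cast <;> linarith [(Nat.cast_nonneg i : (0:ℝ) ≤ i)])
    simpa [mul_add, mul_sub] using this
  · have e : n = (n - k) + k := by omega
    have := Finset.sum_le_card_nsmul (Finset.range k)
      (fun i => g ((n - k + i + 1 : ℕ):ℝ)) (g n + ε)
      (by
        intro i hi
        have hi' : i + 1 ≤ k := by simpa using hi
        have hi'' : (i:ℝ) + 1 ≤ k := by exact_mod_cast hi'
        apply w2 <;> push_cast [hkn.le] <;> linarith [(Nat.cast_nonneg i : (0:ℝ) ≤ i)])
    have e2 : ∑ i ∈ Finset.range n, g ((i + 1 : ℕ):ℝ)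
        = ∑ i ∈ Finset.range (n - k + k), g ((i + 1 : ℕ):ℝ) := by rw [← e]
    rw [e2, Finset.sum_range_add, add_sub_cancel_left]
    simpa [mul_add, mul_sub] using this

lemma g_ii (hM : ∀ t : ℝ, 0 ≤ t → 0 ≤ g t ∧ g t ≤ M) (hc : ContinuousOn g (Ioi 0))
    {a b : ℝ} (ha : 0 ≤ a) (hab : a ≤ b) : IntervalIntegrable g volume a b := by
  rw [intervalIntegrable_iff_integrableOn_Ioc_of_le hab]
  have hsub : Ioc a b ⊆ Ioi 0 := fun z hz => ha.trans_lt hz.1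
  refine IntegrableOn.of_bound (by simp) ?_ M ?_
  · exact (hc.mono hsub).aestronglyMeasurable measurableSet_Ioc
  · refine (ae_restrict_mem measurableSet_Ioc).mono fun z hz => ?_
    have := hM z (hsub hz).le
    rw [Real.norm_eq_abs, abs_of_nonneg this.1]
    exact this.2

lemma cesR (hM : ∀ t : ℝ, 0 ≤ t → 0 ≤ g t ∧ g t ≤ M) (hc : ContinuousOn g (Ioi 0))
    (hK : 0 ≤ K) (hs : ∀ t s : ℝ, 0 < t → t ≤ s → g t - g s ≤ K * ((s - t) / t)) (A : ℝ)
    (h : Tendsto (meanR g) atTop (nhds A)) :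
    Tendsto (fun n : ℕ => g n) atTop (nhds A) := by
  apply taub _ (fun N => ∫ s in (0:ℝ)..N, g s) A (h.comp tendsto_natCast_atTop_atTop)
  intro ε hε
  obtain ⟨δ, h0, h1, hw⟩ := win hK hs ε hε
  refine ⟨δ, h0, h1, 1, fun n k hn hk => ?_⟩
  obtain ⟨hkn, w1, w2⟩ := hw n k hn hk
  have hk0 : (0:ℝ) ≤ k := Nat.cast_nonneg k
  have hn0 : (0:ℝ) ≤ n := Nat.cast_nonneg n
  have hkn' : (k:ℝ) ≤ n := by exact_mod_cast hkn.le
  constructor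
  · push_cast
    rw [intervalIntegral.integral_interval_sub_left (g_ii hM hc le_rfl (by linarith))
      (g_ii hM hc le_rfl hn0)]
    have := intervalIntegral.integral_mono_on (a := (n:ℝ)) (b := n + k) (f := fun _ => g n - ε)
      (g := g) (by linarith) (by simp) (g_ii hM hc hn0 (by linarith))
      (fun z hz => w1 z hz.1 hz.2)
    simpa [mul_add, mul_sub] using this
  · push_cast [hkn.le]
    rw [intervalIntegral.integral_interval_sub_left (g_ii hM hc le_rfl (by linarith))
      (g_ii hM hc le_rfl (by linarith))]
    have := intervalIntegral.integral_mono_on (a := (n:ℝ) - k) (b := n) (g := fun _ => g n + ε)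
      (f := g) (by linarith) (g_ii hM hc (by linarith) (by linarith)) (by simp)
      (fun z hz => w2 z hz.1 hz.2)
    simpa [mul_add, mul_sub] using this

lemma full (hK : 0 ≤ K) (hs : ∀ t s : ℝ, 0 < t → t ≤ s → g t - g s ≤ K * ((s - t) / t)) (A : ℝ)
    (h : Tendsto (fun n : ℕ => g n) atTop (nhds A)) : Tendsto g atTop (nhds A) := by
  have hf : Tendsto (fun t : ℝ => ⌊t⌋₊) atTop atTop := tendsto_nat_floor_atTop
  have hr : Tendsto (fun n : ℕ => K / (n:ℝ)) atTop (nhds 0) :=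
    tendsto_const_div_atTop_nhds_zero_nat K
  have l1 : Tendsto (fun n : ℕ => g n - K / n) atTop (nhds A) := by simpa using h.sub hr
  have l2 : Tendsto (fun n : ℕ => g ((n + 1 : ℕ):ℝ) + K / n) atTop (nhds A) := by
    simpa using ((tendsto_add_atTop_iff_nat (f := fun n : ℕ => g n) 1).2 h).add hr
  refine tendsto_of_tendsto_of_tendsto_of_le_of_le' (l1.comp hf) (l2.comp hf) ?_ ?_
  · filter_upwards [eventually_ge_atTop 1] with t ht
    have h1 : 1 ≤ ⌊t⌋₊ := Nat.le_floor (by simpa using ht)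
    have h2 : (0:ℝ) < (⌊t⌋₊ : ℝ) := by exact_mod_cast h1
    have h3 := Nat.floor_le (show 0 ≤ t by linarith)
    have h4 := Nat.lt_floor_add_one t
    have := hs _ t h2 h3
    have h5 : K * ((t - ⌊t⌋₊) / ⌊t⌋₊) ≤ K / ⌊t⌋₊ := by
      rw [div_eq_mul_one_div K]
      gcongr
      linarith
    simp only [Function.comp]
    linarith
  · filter_upwards [eventually_ge_atTop 1] with t ht
    have h1 : 1 ≤ ⌊t⌋₊ := Nat.le_floor (by simpa using ht)
    have h2 : (0:ℝ) < (⌊t⌋₊ : ℝ) := by exact_mod_cast h1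
    have h3 := Nat.floor_le (show 0 ≤ t by linarith)
    have h4 := Nat.lt_floor_add_one t
    have := hs t ((⌊t⌋₊ + 1 : ℕ):ℝ) (by linarith) (by push_cast; linarith)
    have h5 : K * ((((⌊t⌋₊ + 1 : ℕ):ℝ) - t) / t) ≤ K / ⌊t⌋₊ := by
      rw [div_eq_mul_one_div K]
      have : ((⌊t⌋₊ + 1 : ℕ):ℝ) - t ≤ 1 := by push_cast; linarith
      gcongr
    simp only [Function.comp]
    linarith

lemma meanR_lim (hM : ∀ t : ℝ, 0 ≤ t → 0 ≤ g t ∧ g t ≤ M) (hc : ContinuousOn g (Ioi 0))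
    (A : ℝ) (h : Tendsto g atTop (nhds A)) : Tendsto (meanR g) atTop (nhds A) := by
  have key : Tendsto (fun T : ℝ => ∫ u in (0:ℝ)..1, g (T * u)) atTop
      (nhds (∫ u in (0:ℝ)..1, A)) := by
    apply intervalIntegral.tendsto_integral_filter_of_dominated_convergence (fun _ => M)
    · filter_upwards [eventually_gt_atTop 0] with T hT
      rw [uIoc_of_le zero_le_one]
      refine ContinuousOn.aestronglyMeasurable ?_ measurableSet_Ioc
      exact hc.comp (by fun_prop) (fun u hu => mul_pos hT hu.1)
    · filter_upwards [eventually_gt_atTop 0] with T hT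
      refine Eventually.of_forall fun u hu => ?_
      rw [uIoc_of_le zero_le_one] at hu
      have := hM (T * u) (mul_pos hT hu.1).le
      rw [Real.norm_eq_abs, abs_of_nonneg this.1]
      exact this.2
    · simp
    · refine Eventually.of_forall fun u hu => ?_
      rw [uIoc_of_le zero_le_one] at hu
      exact h.comp (tendsto_id.atTop_mul_const hu.1)
  simp only [intervalIntegral.integral_const, sub_zero, one_smul] at key
  refine key.congr' ?_
  filter_upwards [eventually_gt_atTop 0] with T hT
  rw [intervalIntegral.integral_comp_mul_left _ hT.ne']
  simp [meanR, div_eq_inv_mul]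

lemma max_isCb (hM : ∀ t : ℝ, 0 ≤ t → 0 ≤ g t ∧ g t ≤ M) (hc : ContinuousOn g (Ioi 0)) :
    IsCb (fun t => g (max t 1)) := by
  refine ⟨hc.comp (by fun_prop) (fun t _ => mem_Ioi.2 (lt_of_lt_of_le one_pos (le_max_right t 1))), M, ?_⟩
  intro t _
  have := hM (max t 1) (zero_le_one.trans (le_max_right _ _))
  rw [abs_of_nonneg this.1]
  exact this.2

lemma meanR_max (hM : ∀ t : ℝ, 0 ≤ t → 0 ≤ g t ∧ g t ≤ M) (hc : ContinuousOn g (Ioi 0)) (A : ℝ)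
    (h : Tendsto (meanR fun t => g (max t 1)) atTop (nhds A)) :
    Tendsto (meanR g) atTop (nhds A) := by
  have hcb := max_isCb hM hc
  have h0 : Tendsto (fun T : ℝ => ((∫ u in (0:ℝ)..1, g u) - ∫ u in (0:ℝ)..1, g (max u 1)) / T)
      atTop (nhds 0) := tendsto_const_nhds.div_atTop tendsto_id
  have := h.add h0
  rw [add_zero] at this
  refine this.congr' ?_
  filter_upwards [eventually_ge_atTop 1] with T hT
  simp only [meanR]
  rw [← add_div]
  congr 1
  have e1 := intervalIntegral.integral_add_adjacent_intervals
    (g_ii hM hc le_rfl zero_le_one) (g_ii hM hc zero_le_one hT)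
  have e2 := intervalIntegral.integral_add_adjacent_intervals
    (hcb.ii le_rfl zero_le_one) (hcb.ii zero_le_one (zero_le_one.trans hT))
  have e3 : ∫ u in (1:ℝ)..T, g (max u 1) = ∫ u in (1:ℝ)..T, g u := by
    apply intervalIntegral.integral_congr
    intro u hu
    rw [uIcc_of_le hT] at hu
    simp only [max_eq_left hu.1]
  linarith

end core

/-- for `κ ∈ D(ψ)` and `x ∈ M₊(ψ)`, Cesàro convergence of
`{φ_κ(x)(n)}`, Cesàro convergence of `φ_κ(x)`, almost convergence of
`{φ_κ(x)(n)}`, almost convergence of `φ_κ(x)`, convergence of `{φ_κ(x)(n)}`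
and convergence of `φ(x)` (all to the same value `A`) are equivalent. -/
theorem measurability_equivalences (ψ κ x : ℝ → ℝ) (hψ : OmegaInf ψ) (hκ : MemK κ)
    (hD : DominatedGrowth ψ κ) (hx : MemMplus ψ x) (A : ℝ) :
    (Tendsto (fun N : ℕ => (∑ n ∈ Finset.Icc 1 N, phiW ψ x (κ (n:ℝ))) / (N:ℝ))
        atTop (nhds A) ↔
      Tendsto (cesaro fun t => phiW ψ x (κ t)) atTop (nhds A)) ∧
    (Tendsto (cesaro fun t => phiW ψ x (κ t)) atTop (nhds A) ↔
      ∀ L' : BanachLimitN, fLN L' ψ κ x = A) ∧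
    ((∀ L' : BanachLimitN, fLN L' ψ κ x = A) ↔ ∀ L : BanachLimitR, fL L ψ κ x = A) ∧
    ((∀ L : BanachLimitR, fL L ψ κ x = A) ↔
      Tendsto (fun n : ℕ => phiW ψ x (κ (n:ℝ))) atTop (nhds A)) ∧
    (Tendsto (fun n : ℕ => phiW ψ x (κ (n:ℝ))) atTop (nhds A) ↔
      Tendsto (phiW ψ x) atTop (nhds A)) := by
  obtain ⟨M, K, hM0, hK, hM, hc, hg0, hs⟩ := g_props ψ κ x hψ hκ hD hx
  set g : ℝ → ℝ := fun t => phiW ψ x (κ t) with hg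
  have hbdd : IsBddSeq fun n : ℕ => g n := ⟨M, fun n => by
    have := hM n (Nat.cast_nonneg n)
    rw [abs_of_nonneg this.1]
    exact this.2⟩
  have hces : cesaro g =ᶠ[atTop] meanR g := by
    filter_upwards [eventually_gt_atTop 0] with T hT
    simp [cesaro, meanR, hT.ne']
  have hsum : (fun N : ℕ => (∑ n ∈ Finset.Icc 1 N, phiW ψ x (κ (n:ℝ))) / (N:ℝ)) =
      fun N : ℕ => (∑ i ∈ Finset.range N, g ((i + 1 : ℕ):ℝ)) / (N:ℝ) := by
    funext N
    congr 1
    rw [Finset.range_eq_Ico, Finset.sum_Ico_add' (fun n : ℕ => g n) 0 N 1]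
    rfl
  have T1 : Tendsto (fun n : ℕ => g n) atTop (nhds A) ↔ Tendsto g atTop (nhds A) :=
    ⟨full hK hs A, fun h => h.comp tendsto_natCast_atTop_atTop⟩
  have T2 : Tendsto (fun N : ℕ => (∑ n ∈ Finset.Icc 1 N, phiW ψ x (κ (n:ℝ))) / (N:ℝ))
        atTop (nhds A) ↔ Tendsto g atTop (nhds A) := by
    rw [hsum]
    refine ⟨fun h => T1.1 (cesN hK hs A h), fun h => ?_⟩
    have h1 := ((tendsto_add_atTop_iff_nat (f := fun n : ℕ => g n) 1).2 (T1.2 h)).cesaro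
    exact h1.congr fun N => by rw [div_eq_inv_mul]
  have T3 : Tendsto (cesaro g) atTop (nhds A) ↔ Tendsto g atTop (nhds A) := by
    rw [tendsto_congr' hces]
    exact ⟨fun h => T1.1 (cesR hM hc hK hs A h), meanR_lim hM hc A⟩
  have T4 : (∀ L' : BanachLimitN, fLN L' ψ κ x = A) ↔ Tendsto g atTop (nhds A) := by
    refine ⟨fun h => T1.1 ?_, fun h L => lim_N L _ A hbdd (T1.2 h)⟩
    have h1 := ban_N (fun n : ℕ => g n) A hbdd h
    apply cesN hK hs A
    have h2 : Tendsto (fun N : ℕ => g N / (N:ℝ)) atTop (nhds 0) := by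
      apply squeeze_zero_norm (a := fun N : ℕ => M / (N:ℝ)) _
        (tendsto_const_div_atTop_nhds_zero_nat _)
      intro N
      have := hM N (Nat.cast_nonneg N)
      rw [Real.norm_eq_abs, abs_div, Nat.abs_cast, abs_of_nonneg this.1]
      exact div_le_div_of_nonneg_right this.2 (Nat.cast_nonneg N)
    have h3 := h1.add h2
    rw [add_zero] at h3
    refine h3.congr fun N => ?_
    simp only [meanN]
    rw [← add_div, ← Finset.sum_range_succ (fun n : ℕ => g n) N, Finset.sum_range_succ']
    have : g ((0:ℕ):ℝ) = 0 := by simpa [hg] using hg0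
    rw [this, add_zero]
  have T5 : (∀ L : BanachLimitR, fL L ψ κ x = A) ↔ Tendsto g atTop (nhds A) := by
    have hcb := max_isCb hM hc
    refine ⟨fun h => T3.1 ?_, fun h L => lim_R L _ A hcb ?_⟩
    · rw [tendsto_congr' hces]
      exact meanR_max hM hc A (ban_R _ A hcb h)
    · exact h.comp (tendsto_atTop_mono (fun t => le_max_left t 1) tendsto_id)
  have T6 : Tendsto (phiW ψ x) atTop (nhds A) ↔ Tendsto g atTop (nhds A) := by
    obtain ⟨hmono, hκ0, hmaps, hsurj, -, hκinf⟩ := hκ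
    refine ⟨fun h => h.comp hκinf, fun h => ?_⟩
    rw [Metric.tendsto_atTop] at h ⊢
    intro ε hε
    obtain ⟨T, hT⟩ := h ε hε
    refine ⟨κ (max T 0), fun u hu => ?_⟩
    have hm : max T 0 ∈ Ici (0:ℝ) := mem_Ici.2 (le_max_right T 0)
    obtain ⟨t, ht, rfl⟩ := hsurj (show u ∈ Ici (0:ℝ) from
      le_trans (show (0:ℝ) ≤ _ from hmaps hm) hu)
    exact hT t ((le_max_left _ _).trans ((hmono.le_iff_le hm ht).1 hu))
  refine ⟨T2.trans T3.symm, T3.trans T4.symm, T4.trans T5.symm, T5.trans T1.symm,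
    T1.trans T6.symm⟩
end
end

section
/- Let ψ ∈ Ω∞ (so ψ is strictly increasing and invertible on [0,∞) with ψ(0)=0). Then: (i) if κ ∈ 𝒦 has dominated growth with respect to ψ, then lim_{n→∞} ψ(κ(n))/ψ(κ(n+1)) = 1 (in particular κ has restricted growth with respect to ψ). Moreover the following are equivalent: (ii) there exists κ ∈ 𝒦 of exponential increase with dominated growth with respect to ψ; (iii) there exist C > 0, H > 0 and t₀ > 0 such that ψ(2t)/ψ(t) ≤ 1 + H·ψ(t)^{−1/C} for all t ≥ t₀; (iv) there exists C ≥ 1 such that the function t ↦ ψ^{−1}(t^C) is of exponential increase. -/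
open MeasureTheory Filter Set

noncomputable section

lemma kinks_countable {F : ℝ → ℝ} (hF : ConvexOn ℝ (Ici 0) F) :
    {y : ℝ | 0 < y ∧ ¬ DifferentiableAt ℝ F y}.Countable := by
  have hint : ∀ y : ℝ, 0 < y → y ∈ interior (Ici (0:ℝ)) := by
    intro y hy; rw [interior_Ici]; exact hy
  refine Set.PairwiseDisjoint.countable_of_isOpen (a := {y : ℝ | 0 < y ∧ ¬ DifferentiableAt ℝ F y})
    (s := fun y => Ioo (derivWithin F (Iio y) y) (derivWithin F (Ioi y) y)) ?_
    (fun _ _ => isOpen_Ioo) ?_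
  · have key : ∀ x y : ℝ, 0 < x → x < y →
        derivWithin F (Ioi x) x ≤ derivWithin F (Iio y) y := by
      intro x y hx hxy
      have hy := hx.trans hxy
      exact (hF.rightDeriv_le_slope_of_mem_interior (hint x hx) hy.le hxy).trans
        (hF.slope_le_leftDeriv_of_mem_interior hx.le (hint y hy) hxy)
    intro x hx y hy hxy
    rw [Function.onFun, Set.disjoint_left]
    intro z hz1 hz2
    rcases lt_or_gt_of_ne hxy with h | h
    · have := key x y hx.1 h
      exact absurd (hz1.2.trans_le this) (not_lt.2 hz2.1.le)
    · have := key y x hy.1 h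
      exact absurd (hz2.2.trans_le this) (not_lt.2 hz1.1.le)
  · rintro y ⟨hy, hnd⟩
    rw [nonempty_Ioo]
    refine lt_of_le_of_ne (hF.leftDeriv_le_rightDeriv_of_mem_interior (hint y hy)) ?_
    intro h
    apply hnd
    have h1 := hF.hasDerivWithinAt_leftDeriv_of_mem_interior (hint y hy)
    have h2 := hF.hasDerivWithinAt_rightDeriv_of_mem_interior (hint y hy)
    rw [h] at h1
    have h3 := h1.union h2
    have h4 : HasDerivAt F (derivWithin F (Ioi y) y) y := by
      rw [hasDerivAt_iff_tendsto_slope_left_right]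
      exact ⟨(hasDerivWithinAt_iff_tendsto_slope' (by simp)).1 h1,
        (hasDerivWithinAt_iff_tendsto_slope' (by simp)).1 h2⟩
    exact h4.differentiableAt

lemma cbrt_exists : ∃ c : ℝ → ℝ, StrictMono c ∧ Continuous c ∧ ∀ u, c u ^ 3 = u := by
  have hm : StrictMono (fun x : ℝ => x ^ 3) := Odd.strictMono_pow (by decide)
  have hs : Function.Surjective (fun x : ℝ => x ^ 3) := by
    apply Continuous.surjective (by fun_prop)
    · exact tendsto_pow_atTop (by norm_num)
    · have h := tendsto_neg_atTop_atBot.comp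
        ((tendsto_pow_atTop (α := ℝ) (n := 3) (by norm_num)).comp tendsto_neg_atBot_atTop)
      refine h.congr fun x => ?_
      simp only [Function.comp]; ring
  let e := hm.orderIsoOfSurjective _ hs
  exact ⟨e.symm, e.symm.strictMono, e.symm.continuous, fun u => e.apply_symm_apply u⟩

lemma slope_sum_limit (c : ℝ → ℝ) (hcm : StrictMono c) (hcc : Continuous c)
    (hc3 : ∀ u, c u ^ 3 = u) (d a : ℕ → ℝ) (ha : ∀ n, 0 < a n) (x : ℝ)
    (hsum : ∀ x', Summable fun n => a n * ((c (x' - d n) - c (x - d n)) / (x' - x))) :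
    (Tendsto (fun x' => ∑' n, a n * ((c (x' - d n) - c (x - d n)) / (x' - x)))
      (nhdsWithin x {x}ᶜ) atTop) ∨ ((∀ n, x ≠ d n) ∧ ∃ L ≥ (0:ℝ),
      Tendsto (fun x' => ∑' n, a n * ((c (x' - d n) - c (x - d n)) / (x' - x)))
      (nhdsWithin x {x}ᶜ) (nhds L)) := by
  have hnn : ∀ n x', 0 ≤ (c (x' - d n) - c (x - d n)) / (x' - x) := by
    intro n x'
    rcases le_total x x' with h | h
    · exact div_nonneg (sub_nonneg.2 (hcm.monotone (by linarith))) (by linarith)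
    · exact div_nonneg_of_nonpos (sub_nonpos.2 (hcm.monotone (by linarith))) (by linarith)
  have heq : ∀ n x', x' ≠ x → (c (x' - d n) - c (x - d n)) / (x' - x) =
      (c (x - d n) ^ 2 + c (x - d n) * c (x' - d n) + c (x' - d n) ^ 2)⁻¹ := by
    intro n x' hx
    have h1 : (c (x' - d n) - c (x - d n)) *
      (c (x - d n) ^ 2 + c (x - d n) * c (x' - d n) + c (x' - d n) ^ 2) = x' - x := by
      have := hc3 (x' - d n); have := hc3 (x - d n); linear_combination hc3 (x' - d n) - hc3 (x - d n)
    have h2 : x' - x ≠ 0 := sub_ne_zero.2 hx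
    rw [← h1] at h2
    rw [← h1]
    have h3 := left_ne_zero_of_mul h2
    have h4 := right_ne_zero_of_mul h2
    field_simp
  have hcz : ∀ u, c u = 0 ↔ u = 0 := by
    intro u; constructor
    · intro h; rw [← hc3 u, h]; norm_num
    · rintro rfl; exact pow_eq_zero_iff (n := 3) (by norm_num) |>.1 (hc3 0)
  by_cases hx : ∃ n, x = d n
  · left
    obtain ⟨n, hn⟩ := hx
    have h1 : Tendsto (fun x' => a n * (c (x' - d n) ^ 2)⁻¹) (nhdsWithin x {x}ᶜ) atTop := by
      apply Tendsto.const_mul_atTop (ha n)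
      apply Tendsto.inv_tendsto_nhdsGT_zero
      rw [tendsto_nhdsWithin_iff]
      constructor
      · have : Tendsto (fun x' => c (x' - d n) ^ 2) (nhds x) (nhds (c (x - d n) ^ 2)) :=
          (by fun_prop : Continuous fun x' => c (x' - d n) ^ 2).tendsto x
        rw [hn, sub_self, (hcz 0).2 rfl] at this
        rw [hn]
        simpa using this.mono_left nhdsWithin_le_nhds
      · filter_upwards [self_mem_nhdsWithin] with x' hx'
        have : c (x' - d n) ≠ 0 := by
          rw [Ne, hcz, sub_eq_zero, ← hn]; exact hx'
        exact (by positivity : 0 < c (x' - d n) ^ 2)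
    refine tendsto_atTop_mono' _ ?_ h1
    filter_upwards [self_mem_nhdsWithin] with x' hx'
    have h2 := (hsum x').le_tsum n (fun j _ => mul_nonneg (ha j).le (hnn j x'))
    rw [heq n x' hx', hn, sub_self, (hcz 0).2 rfl] at h2
    rw [hn]
    simpa using h2
  push Not at hx
  have hp : ∀ n, 0 < c (x - d n) ^ 2 := by
    intro n
    have : c (x - d n) ≠ 0 := by
      rw [Ne, hcz, sub_eq_zero]; exact hx n
    positivity
  have hlim : ∀ n, Tendsto (fun x' => a n * ((c (x' - d n) - c (x - d n)) / (x' - x)))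
      (nhdsWithin x {x}ᶜ) (nhds (a n * (3 * c (x - d n) ^ 2)⁻¹)) := by
    intro n
    have h1 : Tendsto (fun x' => a n * (c (x - d n) ^ 2 + c (x - d n) * c (x' - d n) + c (x' - d n) ^ 2)⁻¹)
      (nhds x) (nhds (a n * (c (x - d n) ^ 2 + c (x - d n) * c (x - d n) + c (x - d n) ^ 2)⁻¹)) := by
      apply Tendsto.const_mul
      apply Tendsto.inv₀
      · exact (by fun_prop : Continuous fun x' => c (x - d n) ^ 2 + c (x - d n) * c (x' - d n) + c (x' - d n) ^ 2).tendsto x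
      · nlinarith [hp n]
    rw [show (3 * c (x - d n) ^ 2) = c (x - d n) ^ 2 + c (x - d n) * c (x - d n) + c (x - d n) ^ 2 by ring]
    refine (h1.mono_left nhdsWithin_le_nhds).congr' ?_
    filter_upwards [self_mem_nhdsWithin] with x' hx'
    rw [heq n x' hx']
  by_cases hS : Summable fun n => a n * (3 * c (x - d n) ^ 2)⁻¹
  · right
    refine ⟨hx, ∑' n, a n * (3 * c (x - d n) ^ 2)⁻¹, tsum_nonneg fun n => ?_, ?_⟩
    · have := ha n; have := hp n; positivity
    refine tendsto_tsum_of_dominated_convergence (hS.mul_left 4) hlim ?_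
    filter_upwards [self_mem_nhdsWithin] with x' hx' n
    rw [Real.norm_of_nonneg (mul_nonneg (ha n).le (hnn n x')), heq n x' hx']
    have : 4 * (a n * (3 * c (x - d n) ^ 2)⁻¹) = a n * (3 / 4 * c (x - d n) ^ 2)⁻¹ := by
      have := (hp n).ne'
      field_simp
    rw [this]
    apply mul_le_mul_of_nonneg_left _ (ha n).le
    apply inv_anti₀ (by have := hp n; positivity)
    nlinarith [sq_nonneg (c (x - d n) + 2 * c (x' - d n))]
  · left
    have hT := (not_summable_iff_tendsto_nat_atTop_of_nonneg (fun n => by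
      have := ha n; have := hp n; positivity)).1 hS
    rw [tendsto_atTop]
    intro M
    obtain ⟨N, hN⟩ := (hT.eventually (eventually_gt_atTop M)).exists
    have h1 := tendsto_finsetSum (Finset.range N) (fun n _ => hlim n)
    filter_upwards [h1.eventually (eventually_gt_nhds hN)] with x' hx'
    exact hx'.le.trans ((hsum x').sum_le_tsum _ (fun j _ => mul_nonneg (ha j).le (hnn j x')))

lemma pompeiu (D : Set ℝ) (hD : D.Countable) (hpos : ∀ u ∈ D, 0 < u) :
    ∃ h : ℝ ≃o ℝ, h 0 = 0 ∧ (∀ t, DifferentiableAt ℝ h t) ∧ (∀ t, h t ∈ D → deriv h t = 0) ∧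
      (∀ s t, s ≤ t → h t - h s ≤ t - s) ∧ (∃ K > (0:ℝ), ∀ t ≥ 0, t ≤ K * h t) ∧
      (∀ b > (0:ℝ), ∃ B > (0:ℝ), ∀ t, h t + b ≤ h (t + B)) := by
  obtain ⟨c, hcm, hcc, hc3⟩ := cbrt_exists
  obtain ⟨d, hd⟩ := (hD.insert 1).exists_eq_range (insert_nonempty _ _)
  have hdpos : ∀ n, 0 < d n := by
    intro n
    have : d n ∈ insert 1 D := by rw [hd]; exact mem_range_self n
    rcases this with h | h
    · rw [h]; norm_num
    · exact hpos _ h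
  have hc0 : c 0 = 0 := pow_eq_zero_iff (n := 3) (by norm_num) |>.1 (hc3 0)
  have hep : ∀ n, 0 < c (d n) := fun n => by rw [← hc0]; exact hcm (hdpos n)
  set a : ℕ → ℝ := fun n => (1 / 2) ^ n * min 1 (c (d n) ^ 2) with ha_def
  have ha : ∀ n, 0 < a n := fun n => by have := hep n; simp only [ha_def]; positivity
  have ha1 : ∀ n, a n ≤ (1 / 2) ^ n := fun n =>
    mul_le_of_le_one_right (by positivity) (min_le_left _ _)
  have ha2 : ∀ n, a n ≤ (1 / 2) ^ n * c (d n) ^ 2 := fun n =>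
    mul_le_mul_of_nonneg_left (min_le_right _ _) (by positivity)
  have hg : Summable fun n : ℕ => ((1:ℝ) / 2) ^ n := summable_geometric_two
  set φ : ℕ → ℝ → ℝ := fun n x => c (x - d n) + c (d n) with hφ
  have hbound : ∀ n x, |a n * φ n x| ≤ (1 / 2) ^ n * (4 / 3 * |x|) := by
    intro n x
    rw [abs_mul, abs_of_pos (ha n)]
    have h1 : φ n x * (c (x - d n) ^ 2 - c (x - d n) * c (d n) + c (d n) ^ 2) = x := by
      simp only [hφ]; linear_combination hc3 (x - d n) + hc3 (d n)
    have h2 : 3 / 4 * c (d n) ^ 2 ≤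
        c (x - d n) ^ 2 - c (x - d n) * c (d n) + c (d n) ^ 2 := by
      nlinarith [sq_nonneg (2 * c (x - d n) - c (d n))]
    have h3 : |φ n x| * (3 / 4 * c (d n) ^ 2) ≤ |x| := by
      calc _ ≤ |φ n x| * |c (x - d n) ^ 2 - c (x - d n) * c (d n) + c (d n) ^ 2| :=
            mul_le_mul_of_nonneg_left (h2.trans (le_abs_self _)) (abs_nonneg _)
        _ = |x| := by rw [← abs_mul, h1]
    calc a n * |φ n x| ≤ (1 / 2) ^ n * c (d n) ^ 2 * |φ n x| :=
          mul_le_mul_of_nonneg_right (ha2 n) (abs_nonneg _)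
      _ = (1 / 2) ^ n * (4 / 3 * (|φ n x| * (3 / 4 * c (d n) ^ 2))) := by ring
      _ ≤ _ := by gcongr
  have hsummable : ∀ x, Summable fun n => a n * φ n x := fun x =>
    Summable.of_abs (Summable.of_nonneg_of_le (fun _ => abs_nonneg _) (fun n => hbound n x)
      (hg.mul_right _))
  set k : ℝ → ℝ := fun x => x + ∑' n, a n * φ n x with hk
  have hdiff : ∀ x x', k x' - k x = (x' - x) + ∑' n, a n * (c (x' - d n) - c (x - d n)) := by
    intro x x'
    have h1 : ∑' n, a n * (c (x' - d n) - c (x - d n)) =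
        ∑' n, a n * φ n x' - ∑' n, a n * φ n x := by
      rw [← (hsummable x').tsum_sub (hsummable x)]
      congr 1; ext n; simp only [hφ]; ring
    rw [h1]; simp only [hk]; ring
  have hsd : ∀ x x', Summable fun n => a n * (c (x' - d n) - c (x - d n)) := by
    intro x x'
    refine ((hsummable x').sub (hsummable x)).congr fun n => ?_
    simp only [hφ]; ring
  have hk1 : ∀ x x', x ≤ x' → x' - x ≤ k x' - k x := by
    intro x x' h
    rw [hdiff]
    have : 0 ≤ ∑' n, a n * (c (x' - d n) - c (x - d n)) :=
      tsum_nonneg fun n => mul_nonneg (ha n).le (sub_nonneg.2 (hcm.monotone (by linarith)))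
    linarith
  have hkm : StrictMono k := fun x x' h => by have := hk1 x x' h.le; linarith
  have hk0 : k 0 = 0 := by
    have : ∀ n, φ n 0 = 0 := by
      intro n
      have h := hbound n 0
      simp only [abs_zero, mul_zero] at h
      have h2 := abs_nonpos_iff.1 h
      exact (mul_eq_zero.1 h2).resolve_left (ha n).ne'
    simp [hk, this]
  have hkc : Continuous k := by
    rw [continuous_iff_continuousAt]
    intro x
    refine continuousAt_id.add ?_
    refine tendsto_tsum_of_dominated_convergence
      (bound := fun n => (1 / 2) ^ n * (4 / 3 * (|x| + 1))) (hg.mul_right _) ?_ ?_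
    · intro n
      exact (by fun_prop : Continuous fun x => a n * (c (x - d n) + c (d n))).tendsto x
    · filter_upwards [Metric.ball_mem_nhds x one_pos] with x' hx' n
      refine (hbound n x').trans ?_
      have : |x'| ≤ |x| + 1 := by
        rw [Metric.mem_ball, Real.dist_eq] at hx'
        have := abs_sub_abs_le_abs_sub x' x
        linarith
      gcongr
  have hks : Function.Surjective k := by
    apply hkc.surjective
    · refine tendsto_atTop_mono' _ ?_ tendsto_id
      filter_upwards [eventually_ge_atTop 0] with x hx
      have := hk1 0 x hx
      simp only [id]; linarith
    · refine tendsto_atBot_mono' _ ?_ tendsto_id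
      filter_upwards [eventually_le_atBot 0] with x hx
      have := hk1 x 0 hx
      simp only [id]; linarith
  set e : ℝ ≃o ℝ := hkm.orderIsoOfSurjective k hks with he
  have hek : ∀ x, e x = k x := fun x => rfl
  have hke : ∀ t, k (e.symm t) = t := fun t => e.apply_symm_apply t
  have hslope : ∀ x x', x' ≠ x → slope k x x' =
      1 + ∑' n, a n * ((c (x' - d n) - c (x - d n)) / (x' - x)) := by
    intro x x' hne
    have h0 : x' - x ≠ 0 := sub_ne_zero.2 hne
    rw [slope_def_field, hdiff, add_div, div_self h0, ← tsum_div_const]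
    congr 2; ext n; ring
  have hsq : ∀ t, slope e.symm t = fun t' => (slope k (e.symm t) (e.symm t'))⁻¹ := by
    intro t; ext t'
    rw [slope_def_field, slope_def_field, hke, hke, inv_div]
  have hte : ∀ t, Tendsto e.symm (nhdsWithin t {t}ᶜ) (nhdsWithin (e.symm t) {e.symm t}ᶜ) := by
    intro t
    rw [tendsto_nhdsWithin_iff]
    refine ⟨(e.symm.continuous.tendsto t).mono_left nhdsWithin_le_nhds, ?_⟩
    filter_upwards [self_mem_nhdsWithin] with t' ht'
    exact fun h => ht' (e.symm.injective h)
  have hderiv : ∀ t, HasDerivAt e.symm 0 t ∨ ((∀ n, e.symm t ≠ d n) ∧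
      DifferentiableAt ℝ e.symm t) := by
    intro t
    have hlim := slope_sum_limit c hcm hcc hc3 d a ha (e.symm t) (fun x' => by
      refine ((hsd (e.symm t) x').div_const (x' - e.symm t)).congr fun n => ?_
      ring)
    have hev : (fun x' => 1 + ∑' n, a n * ((c (x' - d n) - c (e.symm t - d n)) / (x' - e.symm t)))
        =ᶠ[nhdsWithin (e.symm t) {e.symm t}ᶜ] slope k (e.symm t) := by
      filter_upwards [self_mem_nhdsWithin] with x' hx'
      exact (hslope _ _ hx').symm
    rcases hlim with h | ⟨hn, L, hL, h⟩
    · left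
      rw [hasDerivAt_iff_tendsto_slope, hsq]
      exact (((tendsto_const_nhds.add_atTop h).congr' hev).comp (hte t)).inv_tendsto_atTop
    · right
      refine ⟨hn, ?_⟩
      have : HasDerivAt e.symm (1 + L)⁻¹ t := by
        rw [hasDerivAt_iff_tendsto_slope, hsq]
        exact (((tendsto_const_nhds.add h).congr' hev).comp (hte t)).inv₀ (by positivity)
      exact this.differentiableAt
  refine ⟨e.symm, ?_, ?_, ?_, ?_, ?_, ?_⟩
  · rw [OrderIso.symm_apply_eq, hek, hk0]
  · intro t
    rcases hderiv t with h | h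
    · exact h.differentiableAt
    · exact h.2
  · intro t ht
    rcases hderiv t with h | h
    · exact h.deriv
    · have : e.symm t ∈ range d := by rw [← hd]; exact Or.inr ht
      obtain ⟨n, hn⟩ := this
      exact absurd hn.symm (h.1 n)
  · intro s t hst
    have := hk1 (e.symm s) (e.symm t) (e.symm.monotone hst)
    rwa [hke, hke] at this
  · refine ⟨1 + 8 / 3, by norm_num, fun t ht => ?_⟩
    have hx : 0 ≤ e.symm t := by
      have h0 : e.symm 0 = 0 := by rw [OrderIso.symm_apply_eq, hek, hk0]
      rw [← h0]; exact e.symm.monotone ht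
    have h1 : k (e.symm t) ≤ e.symm t + 2 * (4 / 3 * |e.symm t|) := by
      simp only [hk]
      gcongr
      have := (hsummable (e.symm t)).tsum_le_tsum (fun n => (le_abs_self _).trans (hbound n (e.symm t)))
        (hg.mul_right _)
      refine this.trans ?_
      rw [tsum_mul_right, tsum_geometric_two]
    rw [hke, abs_of_nonneg hx] at h1
    linarith
  · intro b hb
    refine ⟨b + 2 * (1 + 4 * b), by positivity, fun t => ?_⟩
    rw [OrderIso.le_symm_apply, hek]
    have h1 := hdiff (e.symm t) (e.symm t + b)
    rw [hke] at h1
    have h2 : ∑' n, a n * (c (e.symm t + b - d n) - c (e.symm t - d n)) ≤ 2 * (1 + 4 * b) := by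
      have h3 : ∀ n, a n * (c (e.symm t + b - d n) - c (e.symm t - d n)) ≤
          (1 / 2) ^ n * (1 + 4 * b) := by
        intro n
        set p := c (e.symm t + b - d n) with hp
        set q := c (e.symm t - d n) with hq
        have hpq : 0 ≤ p - q := sub_nonneg.2 (hcm.monotone (by linarith))
        have h5 : p ^ 3 - q ^ 3 = b := by
          rw [hp, hq, hc3, hc3]; ring
        have h6 : (p - q) ^ 3 ≤ 4 * b := by
          nlinarith [mul_nonneg hpq (sq_nonneg (p + q))]
        have h7 : p - q ≤ 1 + 4 * b := by
          by_contra hcon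
          push Not at hcon
          have h8 : 1 ≤ p - q := by linarith
          have h9 : p - q ≤ (p - q) ^ 3 := le_self_pow₀ h8 (by norm_num)
          linarith
        exact mul_le_mul (ha1 n) h7 hpq (by positivity)
      refine ((hsd _ _).tsum_le_tsum h3 (hg.mul_right _)).trans ?_
      rw [tsum_mul_right, tsum_geometric_two]
    linarith

lemma one_add_rpow_le (C a x : ℝ) (hC : 0 < C) (hx : 0 ≤ x) (hxa : x ≤ a) :
    (1 + x) ^ C ≤ 1 + C * Real.exp (C * a) * x := by
  have h1 : (1 + x) ^ C ≤ Real.exp (C * x) := by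
    have : 1 + x ≤ Real.exp x := by have := Real.add_one_le_exp x; linarith
    calc (1 + x) ^ C ≤ (Real.exp x) ^ C := Real.rpow_le_rpow (by linarith) this hC.le
      _ = Real.exp (C * x) := by rw [← Real.exp_mul, mul_comm]
  have h2 : Real.exp (C * x) ≤ 1 + C * x * Real.exp (C * x) := by
    have h3 := Real.add_one_le_exp (-(C * x))
    have h4 : Real.exp (-(C * x)) * Real.exp (C * x) = 1 := by rw [← Real.exp_add]; simp
    nlinarith [Real.exp_pos (C * x)]
  have h5 : Real.exp (C * x) ≤ Real.exp (C * a) := Real.exp_le_exp.2 (by gcongr)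
  have h6 : C * x * Real.exp (C * x) ≤ C * x * Real.exp (C * a) := by gcongr
  linarith

lemma growth_bound (g : ℝ → ℝ) (C : ℝ) (hg : ∀ t > (0:ℝ), 0 < g t)
    (hd : ∀ t > (0:ℝ), DifferentiableAt ℝ g t) (hC : ∀ t > (0:ℝ), deriv g t / g t < C / t)
    (s t : ℝ) (hs : 0 < s) (hst : s ≤ t) : g t ≤ g s * (t / s) ^ C := by
  have hder : ∀ u > (0:ℝ), HasDerivAt (fun u => g u * u ^ (-C))
      (deriv g u * u ^ (-C) + g u * (-C * u ^ (-C - 1))) u := fun u hu =>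
    (hd u hu).hasDerivAt.mul (Real.hasDerivAt_rpow_const (Or.inl hu.ne'))
  have hanti : AntitoneOn (fun u => g u * u ^ (-C)) (Ioi 0) := by
    apply antitoneOn_of_deriv_nonpos (convex_Ioi 0)
    · exact fun u hu => (hder u hu).continuousAt.continuousWithinAt
    · rw [interior_Ioi]; exact fun u hu => (hder u hu).differentiableAt.differentiableWithinAt
    · rw [interior_Ioi]
      intro u hu
      have hu : 0 < u := hu
      rw [(hder u hu).deriv, Real.rpow_sub_one hu.ne']
      have h1 := hC u hu
      rw [div_lt_div_iff₀ (hg u hu) hu] at h1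
      have h2 := Real.rpow_pos_of_pos hu (-C)
      have : deriv g u * u ^ (-C) + g u * (-C * (u ^ (-C) / u)) =
        u ^ (-C) / u * (deriv g u * u - C * g u) := by field_simp; ring
      rw [this]
      exact mul_nonpos_of_nonneg_of_nonpos (by positivity) (by linarith)
  have ht := hs.trans_le hst
  have h := hanti hs ht hst
  simp only at h
  rw [Real.rpow_neg hs.le, Real.rpow_neg ht.le] at h
  rw [Real.div_rpow ht.le hs.le]
  have h1 := Real.rpow_pos_of_pos hs C
  have h2 := Real.rpow_pos_of_pos ht C
  rw [← div_eq_mul_inv, ← div_eq_mul_inv, div_le_iff₀ h2] at h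
  calc g t ≤ _ := h
    _ = _ := by ring

lemma banach_lim (L : BanachLimitN) (a : ℕ → ℝ) (hb : IsBddSeq a) 
    (h : Tendsto a atTop (nhds 1)) : L.toFun a = 1 := by
  have hbs : ∀ N : ℕ, IsBddSeq (fun n => a (n + N)) := by
    intro N; obtain ⟨M, hM⟩ := hb; exact ⟨M, fun n => hM _⟩
  have hsh : ∀ N : ℕ, L.toFun (fun n => a (n + N)) = L.toFun a := by
    intro N
    induction N with
    | zero => rfl
    | succ N ih =>
      rw [← ih, ← L.shift_inv _ (hbs N)]
      congr 1; ext n; congr 1; ring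
  have h1b : IsBddSeq (fun _ => 1) := ⟨1, by simp⟩
  have hcb : ∀ c : ℝ, IsBddSeq (fun _ => c * 1) := fun c => ⟨|c|, by simp⟩
  have hmb : ∀ (c : ℝ) (b : ℕ → ℝ), IsBddSeq b → IsBddSeq (fun n => c * b n) := by
    rintro c b ⟨M, hM⟩
    exact ⟨|c| * M, fun n => by rw [abs_mul]; exact mul_le_mul_of_nonneg_left (hM n) (abs_nonneg _)⟩
  have hab : ∀ (b b' : ℕ → ℝ), IsBddSeq b → IsBddSeq b' → IsBddSeq (fun n => b n + b' n) := by
    rintro b b' ⟨M, hM⟩ ⟨M', hM'⟩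
    exact ⟨M + M', fun n => (abs_add_le _ _).trans (add_le_add (hM n) (hM' n))⟩
  have hlin : ∀ (c e : ℝ) (b : ℕ → ℝ), IsBddSeq b → (∀ n, 0 ≤ c * 1 + e * b n) →
      0 ≤ c + e * L.toFun b := by
    intro c e b hb hn
    have h := L.pos _ (hab _ _ (hcb c) (hmb e b hb)) hn
    rw [L.map_add _ _ (hcb c) (hmb e b hb), L.map_smul _ _ h1b, L.map_smul _ _ hb, L.map_one] at h
    linarith
  have key : ∀ ε > (0:ℝ), |L.toFun a - 1| ≤ ε := by
    intro ε hε
    obtain ⟨N, hN⟩ := Metric.tendsto_atTop.1 h ε hε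
    have hN' : ∀ n, |a (n + N) - 1| < ε := fun n => by
      have := hN (n + N) (by omega); rwa [Real.dist_eq] at this
    have h1 := hlin (1 + ε) (-1) _ (hbs N) (fun n => by have := (abs_lt.1 (hN' n)).2; linarith)
    have h2 := hlin (-(1 - ε)) 1 _ (hbs N) (fun n => by have := (abs_lt.1 (hN' n)).1; linarith)
    rw [hsh] at h1 h2
    rw [abs_le]; constructor <;> linarith
  have := le_of_forall_pos_le_add (a := |L.toFun a - 1|) (b := 0) (fun ε hε => by
    rw [zero_add]; exact key ε hε)
  have := abs_nonpos_iff.1 this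
  linarith

lemma part_i (ψ : ℝ → ℝ) (hmono : StrictMonoOn ψ (Ici 0)) (h0 : ψ 0 = 0)
    (κ : ℝ → ℝ) (hκ : MemK κ) (hdom : DominatedGrowth ψ κ) :
      Tendsto (fun n : ℕ => ψ (κ (n:ℝ)) / ψ (κ ((n:ℝ) + 1))) atTop (nhds 1) ∧
        RestrictedGrowth ψ κ := by
  obtain ⟨hκm, hκ0, hκmap, -, -, -⟩ := hκ
  obtain ⟨hd, C, hC, hlt⟩ := hdom
  have hκp : ∀ t > (0:ℝ), 0 < κ t := fun t ht => by
    rw [← hκ0]; exact hκm self_mem_Ici ht.le ht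
  have hg : ∀ t > (0:ℝ), 0 < ψ (κ t) := fun t ht => by
    rw [← h0]; exact hmono self_mem_Ici (hκp t ht).le (hκp t ht)
  have hgn : ∀ t ≥ (0:ℝ), 0 ≤ ψ (κ t) := fun t ht => by
    rcases ht.eq_or_lt with h | h
    · rw [← h, hκ0, h0]
    · exact (hg t h).le
  have hgm : ∀ s t : ℝ, 0 ≤ s → s ≤ t → ψ (κ s) ≤ ψ (κ t) := fun s t hs hst =>
    hmono.monotoneOn (hκmap hs) (hκmap (hs.trans hst))
      (hκm.monotoneOn hs (hs.trans hst) hst)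
  have hub : ∀ n : ℕ, ψ (κ (n:ℝ)) / ψ (κ ((n:ℝ) + 1)) ≤ 1 := fun n =>
    div_le_one_of_le₀ (hgm _ _ (by positivity) (by linarith)) (hgn _ (by positivity))
  have ht : Tendsto (fun n : ℕ => ψ (κ (n:ℝ)) / ψ (κ ((n:ℝ) + 1))) atTop (nhds 1) := by
    have hl : Tendsto (fun n : ℕ => ((n:ℝ) / ((n:ℝ) + 1)) ^ C) atTop (nhds 1) := by
      have h1 : Tendsto (fun n : ℕ => (n:ℝ) / ((n:ℝ) + 1)) atTop (nhds 1) :=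
        tendsto_natCast_div_add_atTop 1
      simpa using h1.rpow_const (p := C) (Or.inl one_ne_zero)
    refine tendsto_of_tendsto_of_tendsto_of_le_of_le' hl tendsto_const_nhds ?_
      (Eventually.of_forall hub)
    filter_upwards [eventually_gt_atTop 0] with n hn
    have hn' : (0:ℝ) < n := by exact_mod_cast hn
    have h := growth_bound (fun u => ψ (κ u)) C hg hd hlt n (n + 1) hn' (by linarith)
    rw [le_div_iff₀ (hg _ (by positivity))]
    have hp : (0:ℝ) < ((n:ℝ) / ((n:ℝ) + 1)) ^ C := by positivity
    calc ((n:ℝ) / ((n:ℝ) + 1)) ^ C * ψ (κ ((n:ℝ) + 1))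
        ≤ ((n:ℝ) / ((n:ℝ) + 1)) ^ C * (ψ (κ n) * (((n:ℝ) + 1) / n) ^ C) :=
          mul_le_mul_of_nonneg_left h hp.le
      _ = ψ (κ n) := by
        rw [show ((n:ℝ) + 1) / n = ((n:ℝ) / ((n:ℝ) + 1))⁻¹ by rw [inv_div],
          Real.inv_rpow (by positivity)]
        field_simp
  refine ⟨ht, fun L' => banach_lim L' _ ⟨1, fun n => ?_⟩ ht⟩
  rw [abs_of_nonneg (div_nonneg (hgn _ (by positivity)) (hgn _ (by positivity)))]
  exact hub n

def CondIII (ψ : ℝ → ℝ) : Prop := ∃ C > (0:ℝ), ∃ H > (0:ℝ), ∃ t₀ > (0:ℝ), ∀ t ≥ t₀,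
        ψ (2 * t) / ψ t ≤ 1 + H * ψ t ^ (-(1 / C))

lemma ii_iii (ψ : ℝ → ℝ) (hmono : StrictMonoOn ψ (Ici 0)) (h0 : ψ 0 = 0)
    (κ : ℝ → ℝ) (hκ : MemK κ) (hexp : ExpIncrease κ) (hdom : DominatedGrowth ψ κ) :
    CondIII ψ := by
  obtain ⟨hκm, hκ0, hκmap, hκs, -, -⟩ := hκ
  obtain ⟨hd, C, hC, hlt⟩ := hdom
  obtain ⟨a, ha, hexp⟩ := hexp
  have hκp : ∀ t > (0:ℝ), 0 < κ t := fun t ht => by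
    rw [← hκ0]; exact hκm self_mem_Ici ht.le ht
  have hg : ∀ t > (0:ℝ), 0 < ψ (κ t) := fun t ht => by
    rw [← h0]; exact hmono self_mem_Ici (hκp t ht).le (hκp t ht)
  have hg1 := hg 1 one_pos
  refine ⟨C, hC, C * Real.exp (C * a) * a * ψ (κ 1) ^ (1 / C), by positivity, κ 1,
    hκp 1 one_pos, ?_⟩
  intro s hs
  obtain ⟨t, ht0, rfl⟩ := hκs (show s ∈ Ici (0:ℝ) from (hκp 1 one_pos).le.trans hs)
  have ht : 1 ≤ t := (hκm.le_iff_le (show (0:ℝ) ≤ 1 from zero_le_one) ht0).1 hs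
  have htp : 0 < t := by linarith
  have hgt := hg t htp
  have hκt := hκp t htp
  have h1 : ψ (2 * κ t) ≤ ψ (κ (t + a)) :=
    hmono.monotoneOn (show (0:ℝ) ≤ 2 * κ t by positivity) (hκp _ (by positivity)).le
      (hexp t htp).le
  have h2 : ψ (κ (t + a)) ≤ ψ (κ t) * ((t + a) / t) ^ C :=
    growth_bound (fun u => ψ (κ u)) C hg hd hlt t (t + a) htp (by linarith)
  have h3 : ψ (κ t) ≤ ψ (κ 1) * (t / 1) ^ C :=
    growth_bound (fun u => ψ (κ u)) C hg hd hlt 1 t one_pos ht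
  have h4 : ((t + a) / t) ^ C ≤ 1 + C * Real.exp (C * a) * (a / t) := by
    rw [add_div, div_self htp.ne']
    exact one_add_rpow_le C a (a / t) hC (by positivity) (div_le_self ha.le ht)
  have h5 : 1 / t ≤ ψ (κ 1) ^ (1 / C) * ψ (κ t) ^ (-(1 / C)) := by
    rw [Real.rpow_neg hgt.le, ← div_eq_mul_inv, div_le_div_iff₀ htp (by positivity), one_mul]
    calc ψ (κ t) ^ (1 / C) ≤ (ψ (κ 1) * (t / 1) ^ C) ^ (1 / C) :=
          Real.rpow_le_rpow hgt.le h3 (by positivity)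
      _ = ψ (κ 1) ^ (1 / C) * t := by
        rw [div_one, Real.mul_rpow hg1.le (by positivity), ← Real.rpow_mul htp.le,
          mul_one_div_cancel hC.ne', Real.rpow_one]
  rw [div_le_iff₀ hgt]
  calc ψ (2 * κ t) ≤ ψ (κ t) * (1 + C * Real.exp (C * a) * (a / t)) :=
        (h1.trans h2).trans (mul_le_mul_of_nonneg_left h4 hgt.le)
    _ = (1 + C * Real.exp (C * a) * a * (1 / t)) * ψ (κ t) := by ring
    _ ≤ (1 + C * Real.exp (C * a) * a * (ψ (κ 1) ^ (1 / C) * ψ (κ t) ^ (-(1 / C)))) * ψ (κ t) := by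
        gcongr
    _ = _ := by ring

lemma iii_iv (ψ F : ℝ → ℝ) (hmono : StrictMonoOn ψ (Ici 0)) (h0 : ψ 0 = 0)
    (hFn : ∀ y ≥ (0:ℝ), 0 ≤ F y) (hψF : ∀ y ≥ (0:ℝ), ψ (F y) = y) 
    (h : CondIII ψ) : ∃ C ≥ (2:ℝ), ExpIncrease fun t => F (t ^ C) := by
  obtain ⟨C, hC, H, hH, t₀, ht₀, h⟩ := h
  have hψp : ∀ s > (0:ℝ), 0 < ψ s := fun s hs => by
    rw [← h0]; exact hmono self_mem_Ici hs.le hs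
  set E := max C 2 with hE
  have hE2 : 2 ≤ E := le_max_right _ _
  have hCE : C ≤ E := le_max_left _ _
  have hEp : 0 < E := by linarith
  set t₁ := max t₀ (F 1) with ht₁
  have ht₁p : 0 < t₁ := ht₀.trans_le (le_max_left _ _)
  set B := ψ (2 * t₁) with hB
  have hBp : 0 < B := hψp _ (by positivity)
  refine ⟨E, hE2, H + 1 + B ^ (1 / E), by positivity, fun t ht => ?_⟩
  simp only
  set s := F (t ^ E) with hs
  have htE : 0 < t ^ E := by positivity
  have hsn : 0 ≤ s := hFn _ htE.le
  have hψs : ψ s = t ^ E := hψF _ htE.le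
  have hBr : 0 < B ^ (1 / E) := by positivity
  have hT : 0 ≤ (t + (H + 1 + B ^ (1 / E))) ^ E := by positivity
  rw [← hmono.lt_iff_lt (show (0:ℝ) ≤ 2 * s by positivity) (hFn _ hT), hψF _ hT]
  rcases le_total t₁ s with hc | hc
  · have h1 := h s ((le_max_left _ _).trans hc)
    have hsp : 0 < ψ s := hψp _ (ht₁p.trans_le hc)
    have hs1 : 1 ≤ ψ s := by
      rw [← hψF 1 zero_le_one]
      exact hmono.monotoneOn (hFn 1 zero_le_one) hsn ((le_max_right _ _).trans hc)
    have h2 : ψ s ^ (-(1 / C)) ≤ ψ s ^ (-(1 / E)) :=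
      Real.rpow_le_rpow_of_exponent_le hs1 (neg_le_neg (one_div_le_one_div_of_le hC hCE))
    have h3 : ψ s ^ (-(1 / E)) = 1 / t := by
      rw [hψs, ← Real.rpow_mul ht.le, mul_neg, mul_one_div_cancel hEp.ne', Real.rpow_neg_one,
        one_div]
    rw [div_le_iff₀ hsp] at h1
    have h4 : 1 + H * (1 / t) ≤ (1 + H * (1 / t)) ^ E := by
      have h5 : 1 ≤ 1 + H * (1 / t) := by
        have : 0 ≤ H * (1 / t) := by positivity
        linarith
      calc 1 + H * (1 / t) = (1 + H * (1 / t)) ^ (1:ℝ) := (Real.rpow_one _).symm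
        _ ≤ _ := Real.rpow_le_rpow_of_exponent_le h5 (by linarith)
    calc ψ (2 * s) ≤ (1 + H * (1 / t)) * ψ s := by
          refine h1.trans (mul_le_mul_of_nonneg_right ?_ hsp.le)
          rw [← h3]; gcongr
      _ ≤ (1 + H * (1 / t)) ^ E * t ^ E := by
          rw [hψs]; gcongr
      _ = (t + H) ^ E := by
          rw [← Real.mul_rpow (by positivity) ht.le]; congr 1; field_simp
      _ < _ := Real.rpow_lt_rpow (by positivity) (by linarith) hEp
  · calc ψ (2 * s) ≤ B := hmono.monotoneOn (show (0:ℝ) ≤ 2 * s by positivity)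
          (show (0:ℝ) ≤ 2 * t₁ by positivity) (by linarith)
      _ = (B ^ (1 / E)) ^ E := by
          rw [← Real.rpow_mul hBp.le, one_div_mul_cancel hEp.ne', Real.rpow_one]
      _ < _ := Real.rpow_lt_rpow hBr.le (by linarith) hEp

lemma iv_iii (ψ F : ℝ → ℝ) (hmono : StrictMonoOn ψ (Ici 0)) (h0 : ψ 0 = 0)
    (hFn : ∀ y ≥ (0:ℝ), 0 ≤ F y) (hψF : ∀ y ≥ (0:ℝ), ψ (F y) = y)
    (hFψ : ∀ s ≥ (0:ℝ), F (ψ s) = s)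
    (C : ℝ) (hC1 : 1 ≤ C) (h : ExpIncrease fun t => F (t ^ C)) : CondIII ψ := by
  obtain ⟨a, ha, h⟩ := h
  have hC : 0 < C := by linarith
  have hF1 : 0 < F 1 := by
    refine lt_of_le_of_ne (hFn 1 zero_le_one) fun h => ?_
    have := hψF 1 zero_le_one
    rw [← h, h0] at this
    exact zero_ne_one this
  refine ⟨C, hC, C * Real.exp (C * a) * a, by positivity, F 1, hF1, fun s hs => ?_⟩
  have hsp : 0 < s := hF1.trans_le hs
  have h1s : 1 ≤ ψ s := by
    rw [← hψF 1 zero_le_one]; exact hmono.monotoneOn hF1.le hsp.le hs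
  have hψs : 0 < ψ s := by linarith
  set t := ψ s ^ (1 / C) with ht
  have ht1 : 1 ≤ t := Real.one_le_rpow h1s (by positivity)
  have htp : 0 < t := by linarith
  have htC : t ^ C = ψ s := by
    rw [ht, ← Real.rpow_mul hψs.le, one_div_mul_cancel hC.ne', Real.rpow_one]
  have h2 := h t htp
  simp only at h2
  have hT : 0 ≤ (t + a) ^ C := by positivity
  rw [htC, hFψ s hsp.le, ← hmono.lt_iff_lt (show (0:ℝ) ≤ 2 * s by positivity) (hFn _ hT),
    hψF _ hT] at h2
  have h4 : (1 + a / t) ^ C ≤ 1 + C * Real.exp (C * a) * (a / t) :=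
    one_add_rpow_le C a (a / t) hC (by positivity) (div_le_self ha.le ht1)
  rw [div_le_iff₀ hψs, Real.rpow_neg hψs.le, ← ht]
  calc ψ (2 * s) ≤ (t + a) ^ C := h2.le
    _ = (1 + a / t) ^ C * t ^ C := by
        rw [← Real.mul_rpow (by positivity) htp.le]; congr 1; field_simp
    _ ≤ (1 + C * Real.exp (C * a) * (a / t)) * ψ s := by rw [htC]; gcongr
    _ = _ := by rw [div_eq_mul_inv]; ring

lemma convex_inv (ψ F : ℝ → ℝ) (hconc : ConcaveOn ℝ (Ici 0) ψ) (hmono : StrictMonoOn ψ (Ici 0))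
    (hFn : ∀ y ≥ (0:ℝ), 0 ≤ F y) (hψF : ∀ y ≥ (0:ℝ), ψ (F y) = y) : ConvexOn ℝ (Ici 0) F := by
  refine ⟨convex_Ici 0, fun x hx y hy a b ha hb hab => ?_⟩
  have hx : 0 ≤ x := hx
  have hy : 0 ≤ y := hy
  have h := hconc.2 (hFn x hx) (hFn y hy) ha hb hab
  rw [hψF x hx, hψF y hy] at h
  simp only [smul_eq_mul] at h ⊢
  have hxy : 0 ≤ a * x + b * y := by positivity
  have h1 := hFn x hx
  have h2 := hFn y hy
  rw [← hmono.le_iff_le (hFn _ hxy) (show 0 ≤ a * F x + b * F y by positivity), hψF _ hxy]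
  exact h

lemma iv_ii (ψ F : ℝ → ℝ) (hconc : ConcaveOn ℝ (Ici 0) ψ) (hmono : StrictMonoOn ψ (Ici 0))
    (h0 : ψ 0 = 0) (hψn : ∀ t ≥ (0:ℝ), 0 ≤ ψ t)
    (hFn : ∀ y ≥ (0:ℝ), 0 ≤ F y) (hψF : ∀ y ≥ (0:ℝ), ψ (F y) = y)
    (hFψ : ∀ s ≥ (0:ℝ), F (ψ s) = s)
    (C : ℝ) (hC2 : 2 ≤ C) (hexp : ExpIncrease fun t => F (t ^ C)) :
    ∃ κ : ℝ → ℝ, MemK κ ∧ ExpIncrease κ ∧ DominatedGrowth ψ κ := by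
  have hC : 0 < C := by linarith
  have hconv := convex_inv ψ F hconc hmono hFn hψF
  have hFm : StrictMonoOn F (Ici 0) := by
    intro x hx y hy hxy
    rw [← hmono.lt_iff_lt (hFn x hx) (hFn y hy), hψF x hx, hψF y hy]; exact hxy
  have hF0 : F 0 = 0 := by have := hFψ 0 le_rfl; rwa [h0] at this
  set D : Set ℝ := {u | 0 < u ∧ ¬ DifferentiableAt ℝ F (u ^ C)} with hDdef
  have hD : D.Countable := by
    have h1 := kinks_countable hconv
    have h2 : InjOn (fun u : ℝ => u ^ C) D := fun u hu v hv huv =>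
      (Real.rpow_left_inj hu.1.le hv.1.le hC.ne').1 huv
    refine Set.MapsTo.countable_of_injOn (t := {y : ℝ | 0 < y ∧ ¬ DifferentiableAt ℝ F y}) ?_ h2 h1
    exact fun u hu => ⟨Real.rpow_pos_of_pos hu.1 C, hu.2⟩
  obtain ⟨h, hh0, hhd, hhD, hh1, ⟨K, hK, hhK⟩, hhb⟩ := pompeiu D hD (fun u hu => hu.1)
  have hhn : ∀ t ≥ (0:ℝ), 0 ≤ h t := fun t ht => by rw [← hh0]; exact h.monotone ht
  have hhp : ∀ t > (0:ℝ), 0 < h t := fun t ht => by rw [← hh0]; exact h.strictMono ht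
  have hhle : ∀ t ≥ (0:ℝ), h t ≤ t := fun t ht => by
    have := hh1 0 t ht; rw [hh0] at this; linarith
  have hrn : ∀ t ≥ (0:ℝ), 0 ≤ h t ^ C := fun t ht => Real.rpow_nonneg (hhn t ht) C
  have hψκ : ∀ t ≥ (0:ℝ), ψ (F (h t ^ C)) = h t ^ C := fun t ht => hψF _ (hrn t ht)
  have hgd : ∀ t > (0:ℝ), HasDerivAt (fun t => h t ^ C) (deriv h t * C * h t ^ (C - 1)) t :=
    fun t ht => (hhd t).hasDerivAt.rpow_const (Or.inl (hhp t ht).ne')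
  refine ⟨fun t => F (h t ^ C), ⟨?_, ?_, ?_, ?_, ?_, ?_⟩, ?_, ?_, ?_⟩
  · intro s hs t ht hst
    exact hFm (hrn s hs) (hrn t ht) (Real.rpow_lt_rpow (hhn s hs) (h.strictMono hst) hC)
  · simp only [hh0, Real.zero_rpow hC.ne', hF0]
  · exact fun t ht => hFn _ (hrn t ht)
  · intro s hs
    have hp : 0 ≤ ψ s ^ (1 / C) := Real.rpow_nonneg (hψn s hs) _
    refine ⟨h.symm (ψ s ^ (1 / C)), ?_, ?_⟩
    · have : h.symm 0 = 0 := by rw [OrderIso.symm_apply_eq, hh0]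
      rw [mem_Ici, ← this]; exact h.symm.monotone hp
    · simp only [OrderIso.apply_symm_apply]
      rw [← Real.rpow_mul (hψn s hs), one_div_mul_cancel hC.ne', Real.rpow_one, hFψ s hs]
  · intro t ht
    rcases (show (0:ℝ) ≤ t from ht).eq_or_lt with rfl | htp
    · refine HasDerivWithinAt.differentiableWithinAt (f' := 0) ?_
      rw [hasDerivWithinAt_iff_isLittleO]
      simp only [hh0, Real.zero_rpow hC.ne', hF0, sub_zero, smul_zero]
      have hO : (fun t : ℝ => F (h t ^ C)) =O[nhdsWithin 0 (Ici 0)] fun t => t ^ 2 := by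
        refine Asymptotics.IsBigO.of_bound (F 1) ?_
        filter_upwards [self_mem_nhdsWithin, nhdsWithin_le_nhds (Iic_mem_nhds one_pos)] with t h0t ht1
        have h0t : 0 ≤ t := h0t
        have ht1 : t ≤ 1 := ht1
        have hr1 : h t ^ C ≤ t ^ 2 := by
          calc h t ^ C ≤ t ^ C := Real.rpow_le_rpow (hhn t h0t) (hhle t h0t) hC.le
            _ ≤ t ^ (2:ℝ) := Real.rpow_le_rpow_of_exponent_ge_of_imp h0t ht1 hC2 (by
                intro _ h; exact absurd h hC.ne')
            _ = t ^ 2 := by norm_cast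
        have hr2 : h t ^ C ≤ 1 := hr1.trans (by nlinarith)
        have hcv := hconv.2 (show (1:ℝ) ∈ Ici (0:ℝ) from mem_Ici.2 zero_le_one) (show (0:ℝ) ∈ Ici (0:ℝ) from self_mem_Ici)
          (hrn t h0t) (sub_nonneg.2 hr2) (by ring)
        simp only [smul_eq_mul, mul_one, mul_zero, add_zero, hF0] at hcv
        rw [Real.norm_of_nonneg (hFn _ (hrn t h0t)), Real.norm_of_nonneg (sq_nonneg t)]
        calc _ ≤ _ := hcv
          _ ≤ t ^ 2 * F 1 := mul_le_mul_of_nonneg_right hr1 (hFn 1 zero_le_one)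
          _ = _ := by ring
      exact hO.trans_isLittleO ((Asymptotics.isLittleO_pow_id one_lt_two).mono nhdsWithin_le_nhds)
    · refine DifferentiableAt.differentiableWithinAt ?_
      by_cases hdF : DifferentiableAt ℝ F (h t ^ C)
      · exact hdF.comp t (hgd t htp).differentiableAt
      · have hz : deriv h t = 0 := hhD t ⟨hhp t htp, hdF⟩
        have hg := hgd t htp
        rw [hz, zero_mul, zero_mul] at hg
        have hmem : h t ^ C ∈ interior (Ici (0:ℝ)) := by
          rw [interior_Ici]; exact Real.rpow_pos_of_pos (hhp t htp) C
        obtain ⟨M, s, hs, hM⟩ := hconv.locallyLipschitzOn_interior hmem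
        rw [isOpen_interior.nhdsWithin_eq hmem] at hs
        refine HasDerivAt.differentiableAt (f' := 0) ?_
        rw [hasDerivAt_iff_isLittleO] at hg ⊢
        simp only [smul_zero, sub_zero] at hg ⊢
        refine Asymptotics.IsBigO.trans_isLittleO ?_ hg
        refine Asymptotics.IsBigO.of_bound M ?_
        filter_upwards [(hgd t htp).continuousAt.preimage_mem_nhds hs] with t' ht'
        have := hM.dist_le_mul _ ht' _ (mem_of_mem_nhds hs)
        rwa [Real.dist_eq, Real.dist_eq] at this
  · have h1 : Tendsto (fun t => h t ^ C) atTop atTop :=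
      (tendsto_rpow_atTop hC).comp h.tendsto_atTop
    refine Tendsto.comp (f := fun t => h t ^ C) (g := F) ?_ h1
    rw [tendsto_atTop]
    intro b
    filter_upwards [eventually_ge_atTop (ψ (max b 0)), eventually_ge_atTop 0] with y hy hy0
    have hb : (0:ℝ) ≤ max b 0 := le_max_right _ _
    have := hFm.monotoneOn (hψn _ hb) hy0 hy
    rw [hFψ _ hb] at this
    exact (le_max_left _ _).trans this
  · obtain ⟨b, hb, hexp⟩ := hexp
    obtain ⟨B, hB, hhB⟩ := hhb b hb
    refine ⟨B, hB, fun t ht => ?_⟩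
    have h1 := hexp (h t) (hhp t ht)
    have hp := hhp t ht
    refine h1.trans_le (hFm.monotoneOn (show (0:ℝ) ≤ (h t + b) ^ C by positivity)
      (hrn _ (by positivity)) (Real.rpow_le_rpow (by positivity) (hhB t) hC.le))
  · intro t ht
    refine (hgd t ht).differentiableAt.congr_of_eventuallyEq ?_
    filter_upwards [eventually_gt_nhds ht] with u hu
    exact hψκ u hu.le
  · refine ⟨C * K + 1, by positivity, fun t ht => ?_⟩
    have hev : (fun u => ψ (F (h u ^ C))) =ᶠ[nhds t] fun u => h u ^ C := by
      filter_upwards [eventually_gt_nhds ht] with u hu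
      exact hψκ u hu.le
    rw [hev.deriv_eq, (hgd t ht).deriv, hψκ t ht.le, Real.rpow_sub_one (hhp t ht).ne']
    have hp := hhp t ht
    have hpC := Real.rpow_pos_of_pos hp C
    have hd1 : deriv h t ≤ 1 := by
      have hm : Monotone fun u => u - h u := fun u v huv => by
        have := hh1 u v huv; simp only; linarith
      have h3 := hm.deriv_nonneg (x := t)
      have h4 := (hasDerivAt_id t).sub (hhd t).hasDerivAt
      have h5 : deriv (fun u => u - h u) t = 1 - deriv h t := h4.deriv
      rw [h5] at h3
      linarith
    have h6 : deriv h t * C * (h t ^ C / h t) / h t ^ C = deriv h t * C / h t := by field_simp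
    rw [h6, div_lt_div_iff₀ hp ht]
    have h7 := hhK t ht.le
    calc deriv h t * C * t ≤ 1 * C * t := by gcongr
      _ ≤ 1 * C * (K * h t) := by gcongr
      _ < (C * K + 1) * h t := by nlinarith

/-- (i) dominated growth implies `ψ(κ(n))/ψ(κ(n+1)) → 1` (hence
restricted growth); moreover the existence of a `κ ∈ D(ψ)` of exponential
increase is equivalent to `ψ(2t)/ψ(t) = 1 + O(ψ(t)^{-1/C})` and to
`ψ⁻¹(t^C)` being of exponential increase for some `C ≥ 1`. -/
theorem dominated_growth_exp_increase_criteria (ψ : ℝ → ℝ) (hψ : OmegaInf ψ)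
    (hmono : StrictMonoOn ψ (Ici 0)) (h0 : ψ 0 = 0)
    (hsurj : SurjOn ψ (Ici 0) (Ici 0)) :
    (∀ κ : ℝ → ℝ, MemK κ → DominatedGrowth ψ κ →
      Tendsto (fun n : ℕ => ψ (κ (n:ℝ)) / ψ (κ ((n:ℝ) + 1))) atTop (nhds 1) ∧
        RestrictedGrowth ψ κ) ∧
    ((∃ κ : ℝ → ℝ, MemK κ ∧ ExpIncrease κ ∧ DominatedGrowth ψ κ) ↔
      (∃ C > (0:ℝ), ∃ H > (0:ℝ), ∃ t₀ > (0:ℝ), ∀ t ≥ t₀,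
        ψ (2 * t) / ψ t ≤ 1 + H * ψ t ^ (-(1 / C)))) ∧
    ((∃ C > (0:ℝ), ∃ H > (0:ℝ), ∃ t₀ > (0:ℝ), ∀ t ≥ t₀,
        ψ (2 * t) / ψ t ≤ 1 + H * ψ t ^ (-(1 / C))) ↔
      (∃ C ≥ (1:ℝ), ExpIncrease fun t => Function.invFunOn ψ (Ici 0) (t ^ C))) := by
  obtain ⟨hconc, hψn, -, -⟩ := hψ
  have hFn : ∀ y ≥ (0:ℝ), 0 ≤ Function.invFunOn ψ (Ici 0) y := fun y hy =>
    Function.invFunOn_mem (hsurj hy)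
  have hψF : ∀ y ≥ (0:ℝ), ψ (Function.invFunOn ψ (Ici 0) y) = y := fun y hy =>
    Function.invFunOn_eq (hsurj hy)
  have hFψ : ∀ s ≥ (0:ℝ), Function.invFunOn ψ (Ici 0) (ψ s) = s := fun s hs =>
    hmono.injOn (hFn _ (hψn s hs)) hs (hψF _ (hψn s hs))
  refine ⟨fun κ hκ hd => part_i ψ hmono h0 κ hκ hd, ⟨?_, ?_⟩, ⟨?_, ?_⟩⟩
  · rintro ⟨κ, hκ, he, hd⟩
    exact ii_iii ψ hmono h0 κ hκ he hd
  · intro h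
    obtain ⟨C, hC, he⟩ := iii_iv ψ _ hmono h0 hFn hψF h
    exact iv_ii ψ _ hconc hmono h0 hψn hFn hψF hFψ C hC he
  · intro h
    obtain ⟨C, hC, he⟩ := iii_iv ψ _ hmono h0 hFn hψF h
    exact ⟨C, by linarith, he⟩
  · rintro ⟨C, hC, he⟩
    exact iv_iii ψ _ hmono h0 hFn hψF hFψ C hC he
end
end
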